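/- arXiv:0812.3278 — 3 statements merged into one kernel-verified Lean document; each statement's English description precedes it below -/
import Mathlib

section
/- Let a, b, c, d, e, f be nonnegative integers and suppose that s := ((a+c-e)+2(b+d-f))/3 and t := ((a+c-e)-(b+d-f))/3 are integers. Let J be the set of integers j satisfying: 0 ≤ j, j ≤ s+t, s+t ≤ c+d, 0 ≤ s-j, s-j ≤ d, s+t-j ≤ a, j ≤ b, j ≤ b+t, j ≤ c-t, and j ≤ c. If t ≥ 0, then the family of maps (π_{e,f} ∘ μ_e ∘ θ^t ∘ μ_x ∘ β^j ∘ α^{s-j})|_{V(a,b)⊗V(c,d)} indexed by j ∈ J is a basis of the ℂ-vector space of SL₃(ℂ)-equivariant ℂ-linear maps from V(a,b)⊗V(c,d) to V(e,f); if t ≤ 0, the same holds for the family (π_{e,f} ∘ μ_x ∘ ω^{-t} ∘ μ_e ∘ β^j ∘ α^{s+t-j})|_{V(a,b)⊗V(c,d)}, j ∈ J. -/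
open MvPolynomial

noncomputable section

/-- The polynomial ring `R₂ = ℂ[e₁,e₂,e₃,x₁,x₂,x₃,e₁',e₂',e₃',x₁',x₂',x₃']`:
variables `0,1,2` are `e₁,e₂,e₃`; `3,4,5` are `x₁,x₂,x₃`; `6,7,8` are `e₁',e₂',e₃'`;
`9,10,11` are `x₁',x₂',x₃'`. -/
abbrev R12 : Type := MvPolynomial (Fin 12) ℂ

/-- the variable `eᵢ` -/
def ev (i : Fin 3) : Fin 12 := ⟨i.val, by omega⟩

/-- the variable `xᵢ` -/
def xv (i : Fin 3) : Fin 12 := ⟨i.val + 3, by omega⟩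

/-- the variable `eᵢ'` -/
def ep (i : Fin 3) : Fin 12 := ⟨i.val + 6, by omega⟩

/-- the variable `xᵢ'` -/
def xp (i : Fin 3) : Fin 12 := ⟨i.val + 9, by omega⟩

/-- `α = Σᵢ (∂/∂eᵢ)∘(∂/∂xᵢ')` -/
def α : Module.End ℂ R12 :=
  ∑ i : Fin 3, (pderiv (ev i)).toLinearMap ∘ₗ (pderiv (xp i)).toLinearMap

/-- `β = Σᵢ (∂/∂xᵢ)∘(∂/∂eᵢ')` -/
def β : Module.End ℂ R12 :=
  ∑ i : Fin 3, (pderiv (xv i)).toLinearMap ∘ₗ (pderiv (ep i)).toLinearMap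

/-- `θ = Σ_{σ∈S₃} sgn(σ)·(∂/∂e_{σ(1)})∘(∂/∂e'_{σ(2)})∘(mult. by x_{σ(3)})` -/
def θ : Module.End ℂ R12 :=
  ∑ σ : Equiv.Perm (Fin 3), ((Equiv.Perm.sign σ : ℤ) : ℂ) •
    ((pderiv (ev (σ 0))).toLinearMap ∘ₗ (pderiv (ep (σ 1))).toLinearMap ∘ₗ
      LinearMap.mulLeft ℂ (X (xv (σ 2))))

/-- `ω = Σ_{σ∈S₃} sgn(σ)·(mult. by e_{σ(1)})∘(∂/∂x_{σ(2)})∘(∂/∂x'_{σ(3)})` -/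
def ω : Module.End ℂ R12 :=
  ∑ σ : Equiv.Perm (Fin 3), ((Equiv.Perm.sign σ : ℤ) : ℂ) •
    (LinearMap.mulLeft ℂ (X (ev (σ 0))) ∘ₗ (pderiv (xv (σ 1))).toLinearMap ∘ₗ
      (pderiv (xp (σ 2))).toLinearMap)

/-- `μ_e` : the algebra homomorphism substituting `eᵢ' := eᵢ` and fixing all other variables -/
def μe : R12 →ₐ[ℂ] R12 :=
  aeval (fun k : Fin 12 =>
    if h : 6 ≤ k.val ∧ k.val < 9 then X (⟨k.val - 6, by omega⟩ : Fin 12) else X k)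

/-- `μ_x` : the algebra homomorphism substituting `xᵢ' := xᵢ` and fixing all other variables -/
def μx : R12 →ₐ[ℂ] R12 :=
  aeval (fun k : Fin 12 =>
    if h : 9 ≤ k.val then X (⟨k.val - 6, by have := k.isLt; omega⟩ : Fin 12) else X k)

/-- weight recording the total degree in the `e`-variables -/
def wE : Fin 12 → ℕ := fun i => if i.val < 3 then 1 else 0

/-- weight recording the total degree in the `x`-variables -/
def wX : Fin 12 → ℕ := fun i => if 3 ≤ i.val ∧ i.val < 6 then 1 else 0

/-- weight recording the total degree in the `e'`-variables -/
def wEp : Fin 12 → ℕ := fun i => if 6 ≤ i.val ∧ i.val < 9 then 1 else 0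

/-- weight recording the total degree in the `x'`-variables -/
def wXp : Fin 12 → ℕ := fun i => if 9 ≤ i.val then 1 else 0

/-- polynomials of multidegree `(a,b,c,d)` in the variable groups `(e,x,e',x')` -/
def SD4 (a b c d : ℕ) : Submodule ℂ R12 :=
  weightedHomogeneousSubmodule ℂ wE a ⊓ weightedHomogeneousSubmodule ℂ wX b ⊓
  weightedHomogeneousSubmodule ℂ wEp c ⊓ weightedHomogeneousSubmodule ℂ wXp d

/-- `S^eD^f`, realized inside `R₂` as the polynomials of multidegree `(e,f,0,0)` -/
def SD2 (e f : ℕ) : Submodule ℂ R12 := SD4 e f 0 0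

/-- `Δ = Σᵢ (∂/∂eᵢ)∘(∂/∂xᵢ)` on `R₂` (unprimed variables) -/
def Δ₂ : Module.End ℂ R12 :=
  ∑ i : Fin 3, (pderiv (ev i)).toLinearMap ∘ₗ (pderiv (xv i)).toLinearMap

/-- `Δ' = Σᵢ (∂/∂eᵢ')∘(∂/∂xᵢ')` on `R₂` (primed variables) -/
def Δ₂' : Module.End ℂ R12 :=
  ∑ i : Fin 3, (pderiv (ep i)).toLinearMap ∘ₗ (pderiv (xp i)).toLinearMap

/-- `δ` = multiplication by `e₁x₁+e₂x₂+e₃x₃`, acting on the copy of `R` inside `R₂` -/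
def δ₂ : Module.End ℂ R12 :=
  LinearMap.mulLeft ℂ (∑ i : Fin 3, X (ev i) * X (xv i))

/-- `V(a,b)⊗V(c,d)`, realized inside `R₂` as the polynomials of multidegree `(a,b,c,d)` in the
variable groups `(e,x,e',x')` annihilated by `Δ` and `Δ'`. -/
def VV (a b c d : ℕ) : Submodule ℂ R12 :=
  SD4 a b c d ⊓ LinearMap.ker Δ₂ ⊓ LinearMap.ker Δ₂'

/-- `V(e,f) = ker Δ ∩ S^eD^f`, realized inside `R₂` -/
def V2 (e f : ℕ) : Submodule ℂ R12 := LinearMap.ker Δ₂ ⊓ SD2 e f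

/-- `S^{e-1}D^{f-1}`, interpreted as `0` when `e = 0` or `f = 0` -/
def SDsub2 (e f : ℕ) : Submodule ℂ R12 :=
  if e = 0 ∨ f = 0 then ⊥ else SD2 (e - 1) (f - 1)

/-- the inequalities defining the index set `J` of Theorem 3.1 -/
def Jcond (a b c d : ℕ) (s t j : ℤ) : Prop :=
  0 ≤ j ∧ j ≤ s + t ∧ s + t ≤ (c : ℤ) + d ∧ 0 ≤ s - j ∧ s - j ≤ (d : ℤ) ∧
  s + t - j ≤ (a : ℤ) ∧ j ≤ (b : ℤ) ∧ j ≤ (b : ℤ) + t ∧ j ≤ (c : ℤ) - t ∧ j ≤ (c : ℤ)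

/-- the composite map `π_{e,f} ∘ μ_e ∘ θ^t ∘ μ_x ∘ β^j ∘ α^{s-j}` (case `t ≥ 0`) -/
def famθ (π : Module.End ℂ R12) (s t j : ℤ) : Module.End ℂ R12 :=
  π ∘ₗ μe.toLinearMap ∘ₗ (θ ^ t.toNat) ∘ₗ μx.toLinearMap ∘ₗ
    (β ^ j.toNat) ∘ₗ (α ^ (s - j).toNat)

/-- the composite map `π_{e,f} ∘ μ_x ∘ ω^{-t} ∘ μ_e ∘ β^j ∘ α^{s+t-j}` (case `t ≤ 0`) -/
def famω (π : Module.End ℂ R12) (s t j : ℤ) : Module.End ℂ R12 :=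
  π ∘ₗ μx.toLinearMap ∘ₗ (ω ^ (-t).toNat) ∘ₗ μe.toLinearMap ∘ₗ
    (β ^ j.toNat) ∘ₗ (α ^ (s + t - j).toNat)


open scoped MatrixGroups

/-- The diagonal action of `SL₃(ℂ)` on `R₂` by algebra automorphisms: both `e`-triples
transform as the standard representation, `ρ₂(g)(eᵢ) = Σⱼ g_{ji} eⱼ`,
`ρ₂(g)(eᵢ') = Σⱼ g_{ji} eⱼ'`, and both `x`-triples as the dual representation,
`ρ₂(g)(xᵢ) = Σⱼ (g⁻¹)_{ij} xⱼ`, `ρ₂(g)(xᵢ') = Σⱼ (g⁻¹)_{ij} xⱼ'`. -/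
def ρ₂ (g : SL(3, ℂ)) : R12 →ₐ[ℂ] R12 :=
  aeval (fun k : Fin 12 =>
    if h1 : k.val < 3 then
      ∑ j : Fin 3, (g.val j ⟨k.val, h1⟩) • X (ev j)
    else if h2 : k.val < 6 then
      ∑ j : Fin 3, ((g⁻¹).val ⟨k.val - 3, by omega⟩ j) • X (xv j)
    else if h3 : k.val < 9 then
      ∑ j : Fin 3, (g.val j ⟨k.val - 6, by omega⟩) • X (ep j)
    else
      ∑ j : Fin 3, ((g⁻¹).val ⟨k.val - 9, by have := k.isLt; omega⟩ j) • X (xp j))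

/-- A linear map `φ` defined on the subspace `W = V(a,b)⊗V(c,d)` of `R₂` is an
`SL₃(ℂ)`-equivariant map to `T = V(e,f)` if its values lie in `T` and it intertwines the
induced `SL₃(ℂ)`-actions. -/
def IsEquivariantMap (W T : Submodule ℂ R12) (φ : W →ₗ[ℂ] R12) : Prop :=
  (∀ w : W, φ w ∈ T) ∧
  ∀ (g : SL(3, ℂ)) (w : W) (hw : ρ₂ g w.val ∈ W), φ ⟨ρ₂ g w.val, hw⟩ = ρ₂ g (φ w)

/-! ### Basic bookkeeping on the twelve variables -/

theorem forall12 {Q : Fin 12 → Prop} (h1 : ∀ i, Q (ev i)) (h2 : ∀ i, Q (xv i))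
    (h3 : ∀ i, Q (ep i)) (h4 : ∀ i, Q (xp i)) : ∀ k, Q k := by
  intro k
  fin_cases k
  exacts [h1 0, h1 1, h1 2, h2 0, h2 1, h2 2, h3 0, h3 1, h3 2, h4 0, h4 1, h4 2]

theorem sum12 {A : Type*} [AddCommMonoid A] (F : Fin 12 → A) :
    ∑ k, F k = ∑ i, F (ev i) + ∑ i, F (xv i) + ∑ i, F (ep i) + ∑ i, F (xp i) := by
  have h1 : ∀ i : Fin 3, ev i = Fin.castAdd 3 (Fin.castAdd 3 (Fin.castAdd 3 i)) := by
    intro i; rfl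
  have h2 : ∀ i : Fin 3, xv i = Fin.castAdd 3 (Fin.castAdd 3 (Fin.natAdd 3 i)) := by
    intro i; fin_cases i <;> rfl
  have h3 : ∀ i : Fin 3, ep i = Fin.castAdd 3 (Fin.natAdd 6 i) := by
    intro i; fin_cases i <;> rfl
  have h4 : ∀ i : Fin 3, xp i = Fin.natAdd 9 i := by
    intro i; fin_cases i <;> rfl
  simp only [h1, h2, h3, h4]
  exact (Fin.sum_univ_add (a := 9) (b := 3) F).trans (by
    rw [Fin.sum_univ_add (a := 6) (b := 3), Fin.sum_univ_add (a := 3) (b := 3)])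

@[simp] theorem ev_inj {i j : Fin 3} : ev i = ev j ↔ i = j := by simp [ev, Fin.ext_iff]
@[simp] theorem xv_inj {i j : Fin 3} : xv i = xv j ↔ i = j := by simp [xv, Fin.ext_iff]
@[simp] theorem ep_inj {i j : Fin 3} : ep i = ep j ↔ i = j := by simp [ep, Fin.ext_iff]
@[simp] theorem xp_inj {i j : Fin 3} : xp i = xp j ↔ i = j := by simp [xp, Fin.ext_iff]
@[simp] theorem ev_ne_xv {i j : Fin 3} : ev i ≠ xv j := by simp [ev, xv, Fin.ext_iff]; omega
@[simp] theorem ev_ne_ep {i j : Fin 3} : ev i ≠ ep j := by simp [ev, ep, Fin.ext_iff]; omega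
@[simp] theorem ev_ne_xp {i j : Fin 3} : ev i ≠ xp j := by simp [ev, xp, Fin.ext_iff]; omega
@[simp] theorem xv_ne_ev {i j : Fin 3} : xv i ≠ ev j := ev_ne_xv.symm
@[simp] theorem xv_ne_ep {i j : Fin 3} : xv i ≠ ep j := by simp [xv, ep, Fin.ext_iff]; omega
@[simp] theorem xv_ne_xp {i j : Fin 3} : xv i ≠ xp j := by simp [xv, xp, Fin.ext_iff]; omega
@[simp] theorem ep_ne_ev {i j : Fin 3} : ep i ≠ ev j := ev_ne_ep.symm
@[simp] theorem ep_ne_xv {i j : Fin 3} : ep i ≠ xv j := xv_ne_ep.symm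
@[simp] theorem ep_ne_xp {i j : Fin 3} : ep i ≠ xp j := by simp [ep, xp, Fin.ext_iff]; omega
@[simp] theorem xp_ne_ev {i j : Fin 3} : xp i ≠ ev j := ev_ne_xp.symm
@[simp] theorem xp_ne_xv {i j : Fin 3} : xp i ≠ xv j := xv_ne_xp.symm
@[simp] theorem xp_ne_ep {i j : Fin 3} : xp i ≠ ep j := ep_ne_xp.symm

/-- a function on the twelve variables given by its four blocks -/
def blk {A : Type*} (f g h k : Fin 3 → A) : Fin 12 → A := fun n =>
  if h1 : n.val < 3 then f ⟨n.val, h1⟩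
  else if h2 : n.val < 6 then g ⟨n.val - 3, by omega⟩
  else if h3 : n.val < 9 then h ⟨n.val - 6, by omega⟩
  else k ⟨n.val - 9, by have := n.isLt; omega⟩

section
variable {A : Type*} (f g h k : Fin 3 → A) (i : Fin 3)
@[simp] theorem blk_ev : blk f g h k (ev i) = f i := by fin_cases i <;> rfl
@[simp] theorem blk_xv : blk f g h k (xv i) = g i := by fin_cases i <;> rfl
@[simp] theorem blk_ep : blk f g h k (ep i) = h i := by fin_cases i <;> rfl
@[simp] theorem blk_xp : blk f g h k (xp i) = k i := by fin_cases i <;> rfl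
end

theorem wE_eq : wE = blk 1 0 0 0 := by funext k; fin_cases k <;> rfl
theorem wX_eq : wX = blk 0 1 0 0 := by funext k; fin_cases k <;> rfl
theorem wEp_eq : wEp = blk 0 0 1 0 := by funext k; fin_cases k <;> rfl
theorem wXp_eq : wXp = blk 0 0 0 1 := by funext k; fin_cases k <;> rfl
@[simp] theorem μe_ev (i) : μe (X (ev i)) = X (ev i) := by
  rw [μe, aeval_X]; fin_cases i <;> rfl
@[simp] theorem μe_xv (i) : μe (X (xv i)) = X (xv i) := by
  rw [μe, aeval_X]; fin_cases i <;> rfl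
@[simp] theorem μe_ep (i) : μe (X (ep i)) = X (ev i) := by
  rw [μe, aeval_X]; fin_cases i <;> rfl
@[simp] theorem μe_xp (i) : μe (X (xp i)) = X (xp i) := by
  rw [μe, aeval_X]; fin_cases i <;> rfl
@[simp] theorem μx_ev (i) : μx (X (ev i)) = X (ev i) := by
  rw [μx, aeval_X]; fin_cases i <;> rfl
@[simp] theorem μx_xv (i) : μx (X (xv i)) = X (xv i) := by
  rw [μx, aeval_X]; fin_cases i <;> rfl
@[simp] theorem μx_ep (i) : μx (X (ep i)) = X (ep i) := by
  rw [μx, aeval_X]; fin_cases i <;> rfl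
@[simp] theorem μx_xp (i) : μx (X (xp i)) = X (xv i) := by
  rw [μx, aeval_X]; fin_cases i <;> rfl

theorem ρ₂_eq (g : SL(3, ℂ)) : ρ₂ g = aeval (blk
    (fun i => ∑ j, g.val j i • (X (ev j) : R12)) (fun i => ∑ j, (g⁻¹).val i j • X (xv j))
    (fun i => ∑ j, g.val j i • X (ep j)) (fun i => ∑ j, (g⁻¹).val i j • X (xp j))) := rfl

@[simp] theorem ρ₂_ev (g : SL(3, ℂ)) (i) :
    ρ₂ g (X (ev i)) = ∑ j, g.val j i • (X (ev j) : R12) := by rw [ρ₂_eq, aeval_X, blk_ev]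
@[simp] theorem ρ₂_xv (g : SL(3, ℂ)) (i) :
    ρ₂ g (X (xv i)) = ∑ j, (g⁻¹).val i j • (X (xv j) : R12) := by rw [ρ₂_eq, aeval_X, blk_xv]
@[simp] theorem ρ₂_ep (g : SL(3, ℂ)) (i) :
    ρ₂ g (X (ep i)) = ∑ j, g.val j i • (X (ep j) : R12) := by rw [ρ₂_eq, aeval_X, blk_ep]
@[simp] theorem ρ₂_xp (g : SL(3, ℂ)) (i) :
    ρ₂ g (X (xp i)) = ∑ j, (g⁻¹).val i j • (X (xp j) : R12) := by rw [ρ₂_eq, aeval_X, blk_xp]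

theorem μe_eq : μe = aeval (blk (fun i => (X (ev i) : R12)) (fun i => X (xv i))
    (fun i => X (ev i)) (fun i => X (xp i))) := by
  apply MvPolynomial.algHom_ext; apply forall12 <;> intro i <;> simp
theorem μx_eq : μx = aeval (blk (fun i => (X (ev i) : R12)) (fun i => X (xv i))
    (fun i => X (ep i)) (fun i => X (xv i))) := by
  apply MvPolynomial.algHom_ext; apply forall12 <;> intro i <;> simp

/-! ### Weighted homogeneity -/

theorem wh_aeval {M : Type*} [AddCommMonoid M] {w w' : Fin 12 → M} {f : Fin 12 → R12}
    (hf : ∀ k, IsWeightedHomogeneous w' (f k) (w k)) {p : R12} {n : M}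
    (hp : IsWeightedHomogeneous w p n) : IsWeightedHomogeneous w' (aeval f p) n := by
  induction hp using IsWeightedHomogeneous.induction_on with
  | zero => simpa using isWeightedHomogeneous_zero ℂ w' n
  | add p q hp hq h1 h2 => rw [map_add]; exact h1.add h2
  | monomial d r hr =>
    rw [aeval_monomial, algebraMap_eq, ← hr, Finsupp.weight_apply]
    refine IsWeightedHomogeneous.C_mul ?_ r
    rw [Finsupp.prod, Finsupp.sum]
    exact IsWeightedHomogeneous.prod _ _ _ (fun i _ => (hf i).pow _)

theorem wh_map {M N : Type*} [AddCommMonoid M] [AddCommMonoid N] (F : M →+ N) {w : Fin 12 → M}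
    {p : R12} {n : M} (hp : IsWeightedHomogeneous w p n) :
    IsWeightedHomogeneous (fun k => F (w k)) p (F n) := by
  intro d hd
  rw [← hp hd, Finsupp.weight_apply, Finsupp.weight_apply, Finsupp.sum, Finsupp.sum, map_sum]
  simp

theorem wh_add {M : Type*} [AddCommMonoid M] {w w' : Fin 12 → M}
    {p : R12} {n n' : M} (hp : IsWeightedHomogeneous w p n) (hp' : IsWeightedHomogeneous w' p n') :
    IsWeightedHomogeneous (w + w') p (n + n') := by
  intro d hd
  rw [← hp hd, ← hp' hd]
  simp [Finsupp.weight_apply, Finsupp.sum, Finset.sum_add_distrib]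

theorem wh_smul {M : Type*} [AddCommMonoid M] {w : Fin 12 → M} {p : R12} {n : M} (c : ℂ)
    (hp : IsWeightedHomogeneous w p n) : IsWeightedHomogeneous w (c • p) n := by
  rw [smul_eq_C_mul]; exact hp.C_mul c

theorem wh_X {M : Type*} [AddCommMonoid M] (w : Fin 12 → M) (k : Fin 12) {n : M}
    (h : w k = n) : IsWeightedHomogeneous w (X k : R12) n := h ▸ isWeightedHomogeneous_X ℂ w k

theorem mem_SD4 {a b c d : ℕ} {p : R12} : p ∈ SD4 a b c d ↔
    IsWeightedHomogeneous wE p a ∧ IsWeightedHomogeneous wX p b ∧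
    IsWeightedHomogeneous wEp p c ∧ IsWeightedHomogeneous wXp p d := by
  simp [SD4, and_assoc]

/-! ### The chain rule -/

theorem chain (f : Fin 12 → R12) (k : Fin 12) (p : R12) :
    pderiv k (aeval f p) = ∑ l, aeval f (pderiv l p) * pderiv k (f l) := by
  induction p using MvPolynomial.induction_on with
  | C a => simp
  | add p q hp hq => simp only [map_add, hp, hq, add_mul, Finset.sum_add_distrib]
  | mul_X p n hp =>
    rw [map_mul, aeval_X, pderiv_mul, hp]
    simp only [pderiv_mul, map_add, map_mul, aeval_X, add_mul, Finset.sum_add_distrib]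
    congr 1
    · rw [Finset.sum_mul]
      exact Finset.sum_congr rfl fun l _ => by ring
    · rw [Finset.sum_eq_single n]
      · rw [pderiv_X_self, map_one, mul_one]
      · intro b _ hb
        rw [pderiv_X_of_ne hb.symm, map_zero, mul_zero, zero_mul]
      · simp

theorem pd_ev_ρ (g : SL(3, ℂ)) (j : Fin 3) (p : R12) :
    pderiv (ev j) (ρ₂ g p) = ∑ i, g.val j i • ρ₂ g (pderiv (ev i) p) := by
  rw [ρ₂_eq, chain, sum12]
  simp [pderiv_X, Pi.single_apply, smul_eq_C_mul, mul_comm, -aeval_eq_bind₁]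
theorem pd_ep_ρ (g : SL(3, ℂ)) (j : Fin 3) (p : R12) :
    pderiv (ep j) (ρ₂ g p) = ∑ i, g.val j i • ρ₂ g (pderiv (ep i) p) := by
  rw [ρ₂_eq, chain, sum12]
  simp [pderiv_X, Pi.single_apply, smul_eq_C_mul, mul_comm, -aeval_eq_bind₁]
theorem pd_xv_ρ (g : SL(3, ℂ)) (j : Fin 3) (p : R12) :
    pderiv (xv j) (ρ₂ g p) = ∑ i, (g⁻¹).val i j • ρ₂ g (pderiv (xv i) p) := by
  rw [ρ₂_eq, chain, sum12]
  simp [pderiv_X, Pi.single_apply, smul_eq_C_mul, mul_comm, -aeval_eq_bind₁, -Matrix.SpecialLinearGroup.coe_inv]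
theorem pd_xp_ρ (g : SL(3, ℂ)) (j : Fin 3) (p : R12) :
    pderiv (xp j) (ρ₂ g p) = ∑ i, (g⁻¹).val i j • ρ₂ g (pderiv (xp i) p) := by
  rw [ρ₂_eq, chain, sum12]
  simp [pderiv_X, Pi.single_apply, smul_eq_C_mul, mul_comm, -aeval_eq_bind₁, -Matrix.SpecialLinearGroup.coe_inv]

/-! ### Equivariance of the basic operators -/

theorem α_apply (p : R12) : α p = ∑ i, pderiv (ev i) (pderiv (xp i) p) := by
  simp [α, LinearMap.sum_apply]
theorem β_apply (p : R12) : β p = ∑ i, pderiv (xv i) (pderiv (ep i) p) := by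
  simp [β, LinearMap.sum_apply]
theorem Δ_apply (p : R12) : Δ₂ p = ∑ i, pderiv (ev i) (pderiv (xv i) p) := by
  simp [Δ₂, LinearMap.sum_apply]
theorem Δ'_apply (p : R12) : Δ₂' p = ∑ i, pderiv (ep i) (pderiv (xp i) p) := by
  simp [Δ₂', LinearMap.sum_apply]

/-- the alternating sum of a trilinear array -/
def alt {A : Type*} [AddCommGroup A] (T : Fin 3 → Fin 3 → Fin 3 → A) : A :=
  T 0 1 2 + T 1 2 0 + T 2 0 1 - T 0 2 1 - T 1 0 2 - T 2 1 0

theorem sum_perm3 {A : Type*} [AddCommGroup A] [Module ℂ A] (T : Fin 3 → Fin 3 → Fin 3 → A) :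
    ∑ σ : Equiv.Perm (Fin 3), ((Equiv.Perm.sign σ : ℤ) : ℂ) • T (σ 0) (σ 1) (σ 2) = alt T := by
  have h : (Finset.univ : Finset (Equiv.Perm (Fin 3))) =
      {1, c[0, 1, 2], c[0, 2, 1], c[1, 2], c[0, 1], c[0, 2]} := by decide
  have s1 : Equiv.Perm.sign (c[0, 1, 2] : Equiv.Perm (Fin 3)) = 1 := by decide
  have s2 : Equiv.Perm.sign (c[0, 2, 1] : Equiv.Perm (Fin 3)) = 1 := by decide
  have s3 : Equiv.Perm.sign (c[1, 2] : Equiv.Perm (Fin 3)) = -1 := by decide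
  have s4 : Equiv.Perm.sign (c[0, 1] : Equiv.Perm (Fin 3)) = -1 := by decide
  have s5 : Equiv.Perm.sign (c[0, 2] : Equiv.Perm (Fin 3)) = -1 := by decide
  rw [h, Finset.sum_insert (by decide), Finset.sum_insert (by decide),
    Finset.sum_insert (by decide), Finset.sum_insert (by decide), Finset.sum_insert (by decide),
    Finset.sum_singleton, s1, s2, s3, s4, s5]
  have e1 : ∀ i, (c[0, 1, 2] : Equiv.Perm (Fin 3)) i = ![1, 2, 0] i := by decide
  have e2 : ∀ i, (c[0, 2, 1] : Equiv.Perm (Fin 3)) i = ![2, 0, 1] i := by decide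
  have e3 : ∀ i, (c[1, 2] : Equiv.Perm (Fin 3)) i = ![0, 2, 1] i := by decide
  have e4 : ∀ i, (c[0, 1] : Equiv.Perm (Fin 3)) i = ![1, 0, 2] i := by decide
  have e5 : ∀ i, (c[0, 2] : Equiv.Perm (Fin 3)) i = ![2, 1, 0] i := by decide
  simp only [e1, e2, e3, e4, e5]
  simp [alt]
  abel

theorem θ_apply (p : R12) :
    θ p = alt fun i j k => pderiv (ev i) (pderiv (ep j) (X (xv k) * p)) := by
  rw [← sum_perm3]
  simp [θ, LinearMap.sum_apply]

theorem ω_apply (p : R12) :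
    ω p = alt fun i j k => X (ev i) * pderiv (xv j) (pderiv (xp k) p) := by
  rw [← sum_perm3]
  simp [ω, LinearMap.sum_apply]

theorem inv_mul_entry (g : SL(3, ℂ)) (k i : Fin 3) :
    ∑ j, (g⁻¹).val k j * g.val j i = if k = i then 1 else 0 := by
  have : (g⁻¹ * g).val k i = (1 : Matrix (Fin 3) (Fin 3) ℂ) k i := by simp
  rw [Matrix.one_apply] at this
  rw [← this]; rfl

theorem mul_inv_entry (g : SL(3, ℂ)) (k i : Fin 3) :
    ∑ j, g.val k j * (g⁻¹).val j i = if k = i then 1 else 0 := by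
  have : (g * g⁻¹).val k i = (1 : Matrix (Fin 3) (Fin 3) ℂ) k i := by simp
  rw [Matrix.one_apply] at this
  rw [← this]; rfl

theorem contr1 {A : Type*} [AddCommGroup A] [Module ℂ A] (g : SL(3, ℂ))
    (T : Fin 3 → Fin 3 → A) :
    ∑ j, ∑ k, (g⁻¹).val k j • ∑ i, g.val j i • T i k = ∑ i, T i i := by
  have : ∑ j, ∑ k, (g⁻¹).val k j • ∑ i, g.val j i • T i k =
      ∑ k, ∑ i, (∑ j, (g⁻¹).val k j * g.val j i) • T i k := by
    simp only [Finset.smul_sum, smul_smul, Finset.sum_smul]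
    rw [Finset.sum_comm]
    exact Finset.sum_congr rfl fun k _ => Finset.sum_comm
  rw [this]
  simp only [inv_mul_entry, ite_smul, one_smul, zero_smul]
  simp

theorem contr2 {A : Type*} [AddCommGroup A] [Module ℂ A] (g : SL(3, ℂ))
    (T : Fin 3 → Fin 3 → A) :
    ∑ j, ∑ i, g.val j i • ∑ k, (g⁻¹).val k j • T i k = ∑ i, T i i := by
  rw [← contr1 g T]
  refine Finset.sum_congr rfl fun j _ => ?_
  simp only [Finset.smul_sum]
  rw [Finset.sum_comm]
  exact Finset.sum_congr rfl fun k _ => Finset.sum_congr rfl fun i _ => smul_comm _ _ _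

theorem alt_contr {A : Type*} [AddCommGroup A] [Module ℂ A] (g : SL(3, ℂ))
    (T : Fin 3 → Fin 3 → Fin 3 → A) :
    alt (fun p q r => ∑ i, g.val p i • ∑ j, g.val q j • ∑ k, g.val r k • T i j k) = alt T := by
  have hd := g.det_coe
  rw [Matrix.det_fin_three] at hd
  change g.val 0 0 * g.val 1 1 * g.val 2 2 - g.val 0 0 * g.val 1 2 * g.val 2 1
    - g.val 0 1 * g.val 1 0 * g.val 2 2 + g.val 0 1 * g.val 1 2 * g.val 2 0
    + g.val 0 2 * g.val 1 0 * g.val 2 1 - g.val 0 2 * g.val 1 1 * g.val 2 0 = 1 at hd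
  generalize g.val = m at hd
  simp only [alt, Fin.sum_univ_three]
  linear_combination (norm := module) hd • (T 0 1 2 + T 1 2 0 + T 2 0 1 - T 0 2 1 - T 1 0 2 - T 2 1 0)

theorem α_ρ (g : SL(3, ℂ)) (p : R12) : α (ρ₂ g p) = ρ₂ g (α p) := by
  simp only [α_apply, pd_xp_ρ, map_sum, Derivation.map_smul, pd_ev_ρ]
  exact contr1 g fun i k => ρ₂ g (pderiv (ev i) (pderiv (xp k) p))

theorem Δ_ρ (g : SL(3, ℂ)) (p : R12) : Δ₂ (ρ₂ g p) = ρ₂ g (Δ₂ p) := by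
  simp only [Δ_apply, pd_xv_ρ, map_sum, Derivation.map_smul, pd_ev_ρ]
  exact contr1 g fun i k => ρ₂ g (pderiv (ev i) (pderiv (xv k) p))

theorem β_ρ (g : SL(3, ℂ)) (p : R12) : β (ρ₂ g p) = ρ₂ g (β p) := by
  simp only [β_apply, pd_ep_ρ, map_sum, Derivation.map_smul, pd_xv_ρ]
  exact contr2 g fun i k => ρ₂ g (pderiv (xv k) (pderiv (ep i) p))

theorem X_xv_ρ (g : SL(3, ℂ)) (l : Fin 3) :
    (X (xv l) : R12) = ∑ m, g.val l m • ρ₂ g (X (xv m)) := by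
  simp only [ρ₂_xv, Finset.smul_sum, smul_smul]
  rw [Finset.sum_comm]
  simp only [← Finset.sum_smul, mul_inv_entry]
  simp

theorem θ_ρ (g : SL(3, ℂ)) (p : R12) : θ (ρ₂ g p) = ρ₂ g (θ p) := by
  have h : θ (ρ₂ g p) = alt fun a b c => ∑ i, g.val a i • ∑ j, g.val b j • ∑ k, g.val c k •
      ρ₂ g (pderiv (ev i) (pderiv (ep j) (X (xv k) * p))) := by
    rw [θ_apply]
    congr 1
    funext a b c
    have : X (xv c) * ρ₂ g p = ∑ k, g.val c k • ρ₂ g (X (xv k) * p) := by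
      conv_lhs => rw [X_xv_ρ g c]
      simp only [Finset.sum_mul, map_mul, smul_mul_assoc]
    rw [this]
    simp only [map_sum, Derivation.map_smul, pd_ep_ρ, pd_ev_ρ]
    simp only [Finset.smul_sum]
    have e1 : ∀ F : Fin 3 → Fin 3 → Fin 3 → R12,
        ∑ k, ∑ j, ∑ i, F k j i = ∑ i, ∑ j, ∑ k, F k j i := by
      intro F; simp only [Fin.sum_univ_three]; abel
    rw [e1]
    refine Finset.sum_congr rfl fun i _ => Finset.sum_congr rfl fun j _ =>
      Finset.sum_congr rfl fun k _ => ?_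
    simp only [smul_smul]; congr 1; ring
  rw [h, alt_contr, θ_apply]
  simp [alt]

theorem μe_ρ (g : SL(3, ℂ)) (p : R12) : μe (ρ₂ g p) = ρ₂ g (μe p) := by
  have : μe.comp (ρ₂ g) = (ρ₂ g).comp μe := by
    apply MvPolynomial.algHom_ext
    apply forall12 <;> intro i <;> simp [-Matrix.SpecialLinearGroup.coe_inv]
  exact DFunLike.congr_fun this p

theorem μx_ρ (g : SL(3, ℂ)) (p : R12) : μx (ρ₂ g p) = ρ₂ g (μx p) := by
  have : μx.comp (ρ₂ g) = (ρ₂ g).comp μx := by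
    apply MvPolynomial.algHom_ext
    apply forall12 <;> intro i <;> simp [-Matrix.SpecialLinearGroup.coe_inv]
  exact DFunLike.congr_fun this p

/-- the quadric `e·x` -/
def qd : R12 := ∑ i : Fin 3, X (ev i) * X (xv i)

theorem δ_apply (p : R12) : δ₂ p = qd * p := rfl

theorem qd_ρ (g : SL(3, ℂ)) : ρ₂ g qd = qd := by
  simp only [qd, map_sum, map_mul, ρ₂_ev, ρ₂_xv]
  have := contr2 g (fun i k => (X (ev i) * X (xv k) : R12))
  have h2 := contr1 g⁻¹ (fun i k => (X (ev k) * X (xv i) : R12))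
  rw [← h2, inv_inv]
  refine Finset.sum_congr rfl fun j _ => ?_
  rw [Finset.sum_mul]
  refine Finset.sum_congr rfl fun k _ => ?_
  rw [Finset.mul_sum, Finset.smul_sum]
  refine Finset.sum_congr rfl fun i _ => ?_
  rw [smul_mul_assoc, mul_smul_comm]

theorem wh_ρ {A : Type*} [AddCommMonoid A] (a b c d : A) (g : SL(3, ℂ)) {p : R12} {n : A}
    (hp : IsWeightedHomogeneous (blk (fun _ => a) (fun _ => b) (fun _ => c) (fun _ => d)) p n) :
    IsWeightedHomogeneous (blk (fun _ => a) (fun _ => b) (fun _ => c) (fun _ => d))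
      (ρ₂ g p) n := by
  rw [ρ₂_eq]
  refine wh_aeval ?_ hp
  apply forall12 <;> intro i <;>
    simp only [blk_ev, blk_xv, blk_ep, blk_xp] <;>
    refine IsWeightedHomogeneous.sum _ _ _ fun j _ => wh_smul _ (wh_X _ _ ?_) <;>
    simp

theorem SD4_ρ (g : SL(3, ℂ)) {a b c d : ℕ} {p : R12} (hp : p ∈ SD4 a b c d) :
    ρ₂ g p ∈ SD4 a b c d := by
  rw [mem_SD4, wE_eq, wX_eq, wEp_eq, wXp_eq] at *
  exact ⟨wh_ρ _ _ _ _ g hp.1, wh_ρ _ _ _ _ g hp.2.1, wh_ρ _ _ _ _ g hp.2.2.1,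
    wh_ρ _ _ _ _ g hp.2.2.2⟩

theorem V2_ρ (g : SL(3, ℂ)) {e f : ℕ} {p : R12} (hp : p ∈ V2 e f) : ρ₂ g p ∈ V2 e f := by
  refine ⟨?_, SD4_ρ g hp.2⟩
  have : Δ₂ p = 0 := hp.1
  simp [LinearMap.mem_ker, Δ_ρ, this]

/-! ### `ker Δ` meets the ideal generated by the quadric trivially -/

theorem wh_pderiv_lt {w : Fin 12 → ℕ} {p : R12} {n : ℕ} {i : Fin 12}
    (hp : IsWeightedHomogeneous w p n) (h : n < w i) : pderiv i p = 0 := by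
  ext m
  rw [coeff_pderiv, coeff_zero]
  by_cases h0 : coeff (m + Finsupp.single i 1) p = 0
  · rw [h0, zero_mul]
  · have := hp h0
    rw [map_add, Finsupp.weight_single, one_smul] at this
    omega

theorem wh_pderiv {w : Fin 12 → ℕ} {p : R12} {n : ℕ} {i : Fin 12}
    (hp : IsWeightedHomogeneous w p n) : IsWeightedHomogeneous w (pderiv i p) (n - w i) := by
  by_cases h : n < w i
  · rw [wh_pderiv_lt hp h]; exact isWeightedHomogeneous_zero ℂ w _
  · exact hp.pderiv (by omega)

/-- total degree in the unprimed variables -/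
def wT : Fin 12 → ℕ := blk 1 1 0 0

theorem euler_wT {q : R12} {n : ℕ} (hq : IsWeightedHomogeneous wT q n) :
    ∑ i, X (ev i) * pderiv (ev i) q + ∑ i, X (xv i) * pderiv (xv i) q = n • q := by
  have := hq.sum_weight_X_mul_pderiv
  rw [sum12] at this
  simpa [wT] using this

theorem Δ_qd (q : R12) : Δ₂ (qd * q) = qd * Δ₂ q + 3 • q +
    (∑ i, X (ev i) * pderiv (ev i) q + ∑ i, X (xv i) * pderiv (xv i) q) := by
  simp only [Δ_apply, qd, Fin.sum_univ_three]
  simp [pderiv_mul, pderiv_X, Pi.single_apply]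
  ring

theorem wh_Δ {q : R12} {n : ℕ} (hq : IsWeightedHomogeneous wT q n) :
    IsWeightedHomogeneous wT (Δ₂ q) (n - 2) := by
  rw [Δ_apply]
  refine IsWeightedHomogeneous.sum _ _ _ fun i _ => ?_
  have := wh_pderiv (i := ev i) (wh_pderiv (i := xv i) hq)
  simpa [wT, Nat.sub_sub] using this

theorem Δ_low {q : R12} {n : ℕ} (hq : IsWeightedHomogeneous wT q n) (hn : n < 2) :
    Δ₂ q = 0 := by
  rw [Δ_apply]
  refine Finset.sum_eq_zero fun i _ => ?_
  refine wh_pderiv_lt (wh_pderiv (i := xv i) hq) ?_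
  simp [wT]; omega

theorem neg_eigen (n : ℕ) : ∀ (N : ℕ) (q : R12), 0 < N → IsWeightedHomogeneous wT q n →
    qd * Δ₂ q + N • q = 0 → q = 0 := by
  induction n using Nat.strong_induction_on with
  | _ n ih =>
    intro N q hN hq h
    have key : Δ₂ q = 0 := by
      by_cases hn : n < 2
      · exact Δ_low hq hn
      · refine ih (n - 2) (by omega) (3 + (n - 2) + N) _ (by omega) (wh_Δ hq) ?_
        have h2 := congrArg Δ₂ h
        rw [map_add, Δ_qd, euler_wT (wh_Δ hq), map_nsmul, map_zero] at h2
        rw [← h2, add_smul, add_smul]; abel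
    rw [key, mul_zero, zero_add] at h
    have : (N : ℂ) ≠ 0 := by exact_mod_cast hN.ne'
    rw [← Nat.cast_smul_eq_nsmul ℂ] at h
    exact (smul_eq_zero.mp h).resolve_left this

theorem qd_ne : qd ≠ 0 := by
  intro h
  have := congrArg (MvPolynomial.eval (fun k => if k = ev 0 ∨ k = xv 0 then (1 : ℂ) else 0)) h
  simp [qd, Fin.sum_univ_three] at this

theorem wh_qd : IsWeightedHomogeneous wT qd 2 := by
  refine IsWeightedHomogeneous.sum _ _ _ fun i _ => ?_
  exact IsWeightedHomogeneous.mul (m := 1) (n := 1) (wh_X _ _ (by simp [wT]))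
    (wh_X _ _ (by simp [wT]))

theorem V2_wT {e f : ℕ} {u : R12} (hu : u ∈ V2 e f) : IsWeightedHomogeneous wT u (e + f) := by
  have h := (mem_SD4.mp hu.2)
  have h2 := wh_add h.1 h.2.1
  rw [wE_eq, wX_eq] at h2
  convert h2 using 1
  funext k; revert k; apply forall12 <;> intro i <;> simp [wT]

theorem V2_inj {e f : ℕ} {u : R12} (hu : u ∈ V2 e f) (hd : qd ∣ u) : u = 0 := by
  classical
  obtain ⟨q, rfl⟩ := hd
  have hw := V2_wT hu
  letI : GradedAlgebra (weightedHomogeneousSubmodule ℂ wT) := weightedGradedAlgebra ℂ wT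
  have h1 := DirectSum.coe_decompose_mul_of_left_mem (𝒜 := weightedHomogeneousSubmodule ℂ wT)
    (a := qd) (b := q) (e + f) wh_qd
  rw [DirectSum.decompose_of_mem_same _ hw] at h1
  split_ifs at h1 with hle
  · set q' := ((DirectSum.decompose (weightedHomogeneousSubmodule ℂ wT) q) (e + f - 2))
    have hq' : IsWeightedHomogeneous wT (q' : R12) (e + f - 2) := q'.2
    have h0 : Δ₂ (qd * (q' : R12)) = 0 := by rw [← h1]; exact hu.1
    rw [Δ_qd, euler_wT hq', add_assoc, ← add_smul] at h0
    have := neg_eigen _ _ _ (by omega) hq' h0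
    rw [h1, this, mul_zero]
  · exact h1

/-! ### The parametrization `κ` of the quadric cone -/

/-- `κ` multiplies `e₁,e₃` by `x₂` and replaces `e₂` by `-(e₁x₁+e₃x₃)` -/
def κ : R12 →ₐ[ℂ] R12 := aeval (blk
  ![X (ev 0) * X (xv 1), -(X (ev 0) * X (xv 0) + X (ev 2) * X (xv 2)), X (ev 2) * X (xv 1)]
  (fun i => X (xv i)) (fun i => X (ep i)) (fun i => X (xp i)))

@[simp] theorem κ_ev0 : κ (X (ev 0)) = X (ev 0) * X (xv 1) := by simp [κ, -aeval_eq_bind₁]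
@[simp] theorem κ_ev1 : κ (X (ev 1)) = -(X (ev 0) * X (xv 0) + X (ev 2) * X (xv 2)) := by
  simp [κ, -aeval_eq_bind₁]
@[simp] theorem κ_ev2 : κ (X (ev 2)) = X (ev 2) * X (xv 1) := by simp [κ, -aeval_eq_bind₁]
@[simp] theorem κ_xv (i) : κ (X (xv i)) = X (xv i) := by simp [κ, -aeval_eq_bind₁]
@[simp] theorem κ_ep (i) : κ (X (ep i)) = X (ep i) := by simp [κ, -aeval_eq_bind₁]
@[simp] theorem κ_xp (i) : κ (X (xp i)) = X (xp i) := by simp [κ, -aeval_eq_bind₁]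

theorem κ_qd : κ qd = 0 := by
  simp [qd, Fin.sum_univ_three]; ring

theorem κ_of_dvd {p : R12} (h : qd ∣ p) : κ p = 0 := by
  obtain ⟨q, rfl⟩ := h
  rw [map_mul, κ_qd, zero_mul]

theorem κ_congr_aux {A : Type*} [CommRing A] [Algebra ℂ A] (mk : R12 →ₐ[ℂ] A) (hq : mk qd = 0)
    {e : ℕ} {p : R12} (hp : IsWeightedHomogeneous wE p e) :
    mk (X (xv 1) ^ e * p) = mk (κ p) := by
  rw [wE_eq] at hp
  induction hp using IsWeightedHomogeneous.induction_on with
  | zero => simp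
  | add p q hp hq h1 h2 => rw [mul_add, map_add, h1, h2, map_add, map_add]
  | monomial d r hr =>
    have hX : ∀ k, mk (κ (X k)) = mk (X (xv 1)) ^ (blk 1 0 0 0 k : ℕ) * mk (X k) := by
      apply forall12 <;> intro i <;> simp only [blk_ev, blk_xv, blk_ep, blk_xp]
      · fin_cases i
        · simp [mul_comm]
        · have : mk (X (xv 1) * X (ev 1) - κ (X (ev 1))) = 0 := by
            rw [← hq]; congr 1
            simp [qd, Fin.sum_univ_three]; ring
          rw [map_sub, sub_eq_zero, map_mul] at this
          simpa using this.symm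
        · simp [mul_comm]
      all_goals simp
    have hk : mk (κ (d.prod fun k n => X k ^ n)) =
        mk (X (xv 1)) ^ e * mk (d.prod fun k n => X k ^ n) := by
      rw [← hr, Finsupp.weight_apply, Finsupp.prod, Finsupp.sum, map_prod, map_prod, map_prod,
        ← Finset.prod_pow_eq_pow_sum, ← Finset.prod_mul_distrib]
      refine Finset.prod_congr rfl fun k _ => ?_
      simp only [map_pow, hX, mul_pow, smul_eq_mul]
      rw [← pow_mul, mul_comm (d k)]
    rw [monomial_eq, map_mul, map_mul, map_mul, map_mul, hk, map_pow, algHom_C, algHom_C,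
      AlgHom.commutes]
    ring

theorem κ_congr {e : ℕ} {p : R12} (hp : IsWeightedHomogeneous wE p e) :
    qd ∣ X (xv 1) ^ e * p - κ p := by
  have h := κ_congr_aux (Ideal.Quotient.mkₐ ℂ (Ideal.span {qd}))
    (Ideal.Quotient.eq_zero_iff_mem.mpr (Ideal.mem_span_singleton_self _)) hp
  rw [← Ideal.mem_span_singleton, ← Ideal.Quotient.eq_zero_iff_mem]
  rw [← sub_eq_zero, ← map_sub] at h
  exact h

theorem xv1_not_dvd_qd : ¬ (X (xv 1) : R12) ∣ qd := by
  rintro ⟨q, h⟩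
  have := congrArg (MvPolynomial.eval (fun k => if k = ev 0 ∨ k = xv 0 then (1 : ℂ) else 0)) h
  simp [qd, Fin.sum_univ_three] at this

theorem dvd_of_X_pow (n : ℕ) : ∀ p : R12, qd ∣ X (xv 1) ^ n * p → qd ∣ p := by
  rintro p ⟨q, hq⟩
  have h1 : (X (xv 1) : R12) ^ n ∣ qd * q := ⟨p, hq.symm⟩
  have h2 := (X_prime (R := ℂ) (i := xv 1)).pow_dvd_of_dvd_mul_left n xv1_not_dvd_qd h1
  obtain ⟨r, rfl⟩ := h2
  refine ⟨r, ?_⟩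
  have h3 : (X (xv 1) : R12) ^ n ≠ 0 := pow_ne_zero _ (X_ne_zero _)
  apply mul_left_cancel₀ h3
  rw [hq]; ring

theorem dvd_of_κ {e : ℕ} {p : R12} (hp : IsWeightedHomogeneous wE p e) (h : κ p = 0) :
    qd ∣ p := by
  have := κ_congr hp
  rw [h, sub_zero] at this
  exact dvd_of_X_pow e p this

theorem V2_κ {e f : ℕ} {u : R12} (hu : u ∈ V2 e f) (h : κ u = 0) : u = 0 :=
  V2_inj hu (dvd_of_κ (mem_SD4.mp hu.2).1 h)

/-! ### Multidegrees of the operators -/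

theorem SD4_pderiv_ev {a b c d : ℕ} {p : R12} (i : Fin 3) (h : p ∈ SD4 a b c d) :
    pderiv (ev i) p ∈ SD4 (a - 1) b c d := by
  rw [mem_SD4] at h ⊢
  obtain ⟨h1, h2, h3, h4⟩ := h
  refine ⟨?_, ?_, ?_, ?_⟩
  · simpa [wE_eq] using wh_pderiv (i := ev i) h1
  · simpa [wX_eq] using wh_pderiv (i := ev i) h2
  · simpa [wEp_eq] using wh_pderiv (i := ev i) h3
  · simpa [wXp_eq] using wh_pderiv (i := ev i) h4

theorem SD4_pderiv_xv {a b c d : ℕ} {p : R12} (i : Fin 3) (h : p ∈ SD4 a b c d) :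
    pderiv (xv i) p ∈ SD4 a (b - 1) c d := by
  rw [mem_SD4] at h ⊢
  obtain ⟨h1, h2, h3, h4⟩ := h
  refine ⟨?_, ?_, ?_, ?_⟩
  · simpa [wE_eq] using wh_pderiv (i := xv i) h1
  · simpa [wX_eq] using wh_pderiv (i := xv i) h2
  · simpa [wEp_eq] using wh_pderiv (i := xv i) h3
  · simpa [wXp_eq] using wh_pderiv (i := xv i) h4

theorem SD4_pderiv_ep {a b c d : ℕ} {p : R12} (i : Fin 3) (h : p ∈ SD4 a b c d) :
    pderiv (ep i) p ∈ SD4 a b (c - 1) d := by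
  rw [mem_SD4] at h ⊢
  obtain ⟨h1, h2, h3, h4⟩ := h
  refine ⟨?_, ?_, ?_, ?_⟩
  · simpa [wE_eq] using wh_pderiv (i := ep i) h1
  · simpa [wX_eq] using wh_pderiv (i := ep i) h2
  · simpa [wEp_eq] using wh_pderiv (i := ep i) h3
  · simpa [wXp_eq] using wh_pderiv (i := ep i) h4

theorem SD4_pderiv_xp {a b c d : ℕ} {p : R12} (i : Fin 3) (h : p ∈ SD4 a b c d) :
    pderiv (xp i) p ∈ SD4 a b c (d - 1) := by
  rw [mem_SD4] at h ⊢
  obtain ⟨h1, h2, h3, h4⟩ := h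
  refine ⟨?_, ?_, ?_, ?_⟩
  · simpa [wE_eq] using wh_pderiv (i := xp i) h1
  · simpa [wX_eq] using wh_pderiv (i := xp i) h2
  · simpa [wEp_eq] using wh_pderiv (i := xp i) h3
  · simpa [wXp_eq] using wh_pderiv (i := xp i) h4

theorem SD4_X_xv {a b c d : ℕ} {p : R12} (i : Fin 3) (h : p ∈ SD4 a b c d) :
    X (xv i) * p ∈ SD4 a (b + 1) c d := by
  rw [mem_SD4] at h ⊢
  obtain ⟨h1, h2, h3, h4⟩ := h
  refine ⟨?_, ?_, ?_, ?_⟩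
  · simpa using (wh_X wE (xv i) (n := 0) (by simp [wE_eq])).mul h1
  · simpa [add_comm] using (wh_X wX (xv i) (n := 1) (by simp [wX_eq])).mul h2
  · simpa using (wh_X wEp (xv i) (n := 0) (by simp [wEp_eq])).mul h3
  · simpa using (wh_X wXp (xv i) (n := 0) (by simp [wXp_eq])).mul h4

theorem SD4_α {a b c d : ℕ} {p : R12} (h : p ∈ SD4 a b c d) : α p ∈ SD4 (a - 1) b c (d - 1) := by
  rw [α_apply]
  exact Submodule.sum_mem _ fun i _ => SD4_pderiv_ev i (SD4_pderiv_xp i h)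

theorem SD4_β {a b c d : ℕ} {p : R12} (h : p ∈ SD4 a b c d) : β p ∈ SD4 a (b - 1) (c - 1) d := by
  rw [β_apply]
  exact Submodule.sum_mem _ fun i _ => SD4_pderiv_xv i (SD4_pderiv_ep i h)

theorem SD4_θ {a b c d : ℕ} {p : R12} (h : p ∈ SD4 a b c d) :
    θ p ∈ SD4 (a - 1) (b + 1) (c - 1) d := by
  rw [θ_apply]
  have h1 : ∀ i j k, pderiv (ev i) (pderiv (ep j) (X (xv k) * p)) ∈
      SD4 (a - 1) (b + 1) (c - 1) d := fun i j k => SD4_pderiv_ev i (SD4_pderiv_ep j (SD4_X_xv k h))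
  unfold alt
  repeat' first | apply Submodule.add_mem | apply Submodule.sub_mem | apply h1

theorem SD4_αpow {a b c d : ℕ} {p : R12} (n : ℕ) (h : p ∈ SD4 a b c d) :
    (α ^ n) p ∈ SD4 (a - n) b c (d - n) := by
  induction n with
  | zero => simpa using h
  | succ n ih =>
    rw [pow_succ', Module.End.mul_apply, ← Nat.sub_sub, ← Nat.sub_sub]
    exact SD4_α ih

theorem SD4_βpow {a b c d : ℕ} {p : R12} (n : ℕ) (h : p ∈ SD4 a b c d) :
    (β ^ n) p ∈ SD4 a (b - n) (c - n) d := by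
  induction n with
  | zero => simpa using h
  | succ n ih =>
    rw [pow_succ', Module.End.mul_apply, ← Nat.sub_sub, ← Nat.sub_sub]
    exact SD4_β ih

theorem SD4_θpow {a b c d : ℕ} {p : R12} (n : ℕ) (h : p ∈ SD4 a b c d) :
    (θ ^ n) p ∈ SD4 (a - n) (b + n) (c - n) d := by
  induction n with
  | zero => simpa using h
  | succ n ih =>
    rw [pow_succ', Module.End.mul_apply, ← Nat.sub_sub, ← Nat.sub_sub, ← add_assoc]
    exact SD4_θ ih

theorem SD4_μx {a b c d : ℕ} {p : R12} (h : p ∈ SD4 a b c d) : μx p ∈ SD4 a (b + d) c 0 := by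
  rw [mem_SD4] at h ⊢
  obtain ⟨h1, h2, h3, h4⟩ := h
  rw [μx_eq]
  refine ⟨wh_aeval (forall12 ?_ ?_ ?_ ?_) h1, wh_aeval (forall12 ?_ ?_ ?_ ?_) (wh_add h2 h4),
    wh_aeval (forall12 ?_ ?_ ?_ ?_) h3, ?_⟩
  on_goal 13 =>
    refine wh_aeval (w := 0) (forall12 ?_ ?_ ?_ ?_) ?_
    on_goal 5 => intro m _; simp [Finsupp.weight_apply]
  all_goals
    intro i
    simp only [blk_ev, blk_xv, blk_ep, blk_xp]
    exact wh_X _ _ (by simp [wE_eq, wX_eq, wEp_eq, wXp_eq])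

theorem SD4_μe {a b c d : ℕ} {p : R12} (h : p ∈ SD4 a b c d) : μe p ∈ SD4 (a + c) b 0 d := by
  rw [mem_SD4] at h ⊢
  obtain ⟨h1, h2, h3, h4⟩ := h
  rw [μe_eq]
  refine ⟨wh_aeval (forall12 ?_ ?_ ?_ ?_) (wh_add h1 h3), wh_aeval (forall12 ?_ ?_ ?_ ?_) h2,
    ?_, wh_aeval (forall12 ?_ ?_ ?_ ?_) h4⟩
  on_goal 9 =>
    refine wh_aeval (w := 0) (forall12 ?_ ?_ ?_ ?_) ?_
    on_goal 5 => intro m _; simp [Finsupp.weight_apply]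
  all_goals
    intro i
    simp only [blk_ev, blk_xv, blk_ep, blk_xp]
    exact wh_X _ _ (by simp [wE_eq, wX_eq, wEp_eq, wXp_eq])

/-- the composite before projecting -/
def inner (s t j : ℤ) : Module.End ℂ R12 :=
  μe.toLinearMap ∘ₗ (θ ^ t.toNat) ∘ₗ μx.toLinearMap ∘ₗ (β ^ j.toNat) ∘ₗ (α ^ (s - j).toNat)

theorem famθ_apply (π : Module.End ℂ R12) (s t j : ℤ) (p : R12) :
    famθ π s t j p = π (inner s t j p) := rfl

theorem inner_apply (s t j : ℤ) (p : R12) :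
    inner s t j p = μe ((θ ^ t.toNat) (μx ((β ^ j.toNat) ((α ^ (s - j).toNat) p)))) := rfl

theorem pow_ρ {T : Module.End ℂ R12} {g : SL(3, ℂ)} (hT : ∀ p, T (ρ₂ g p) = ρ₂ g (T p)) (n : ℕ)
    (p : R12) : (T ^ n) (ρ₂ g p) = ρ₂ g ((T ^ n) p) := by
  induction n generalizing p with
  | zero => simp
  | succ n ih => rw [pow_succ, Module.End.mul_apply, Module.End.mul_apply, hT, ih]

theorem inner_ρ (s t j : ℤ) (g : SL(3, ℂ)) (p : R12) :
    inner s t j (ρ₂ g p) = ρ₂ g (inner s t j p) := by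
  rw [inner_apply, inner_apply, pow_ρ (α_ρ g), pow_ρ (β_ρ g), μx_ρ, pow_ρ (θ_ρ g), μe_ρ]

theorem inner_SD2 {a b c d e f : ℕ} {s t j : ℤ}
    (hs : 3 * s = ((a : ℤ) + c - e) + 2 * ((b : ℤ) + d - f))
    (ht : 3 * t = ((a : ℤ) + c - e) - ((b : ℤ) + d - f)) (h0 : 0 ≤ t)
    (hj : Jcond a b c d s t j) {p : R12} (hp : p ∈ SD4 a b c d) : inner s t j p ∈ SD2 e f := by
  have := SD4_μe (SD4_θpow t.toNat (SD4_μx (SD4_βpow j.toNat (SD4_αpow (s - j).toNat hp))))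
  rw [inner_apply, SD2]
  obtain ⟨h1, h2, h3, h4, h5, h6, h7, h8, h9, h10⟩ := hj
  convert this using 2 <;> omega

/-! ### The projection -/

/-- the defining property of the projection -/
def IsProj (e f : ℕ) (π : Module.End ℂ R12) : Prop :=
  ∀ p ∈ SD2 e f, π p ∈ V2 e f ∧ p - π p ∈ (SDsub2 e f).map δ₂

theorem IsProj.dvd {e f : ℕ} {π : Module.End ℂ R12} (hπ : IsProj e f π) {p : R12}
    (hp : p ∈ SD2 e f) : qd ∣ p - π p := by
  obtain ⟨q, _, hq⟩ := (hπ p hp).2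
  exact ⟨q, hq.symm⟩

theorem IsProj.κ_eq {e f : ℕ} {π : Module.End ℂ R12} (hπ : IsProj e f π) {p : R12}
    (hp : p ∈ SD2 e f) : κ (π p) = κ p := by
  have := κ_of_dvd (hπ.dvd hp)
  rw [map_sub, sub_eq_zero] at this
  exact this.symm

theorem IsProj.ρ_eq {e f : ℕ} {π : Module.End ℂ R12} (hπ : IsProj e f π) {p : R12}
    (hp : p ∈ SD2 e f) (g : SL(3, ℂ)) : π (ρ₂ g p) = ρ₂ g (π p) := by
  have hp' : ρ₂ g p ∈ SD2 e f := SD4_ρ g hp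
  rw [← sub_eq_zero]
  refine V2_inj (Submodule.sub_mem _ (hπ _ hp').1 (V2_ρ g (hπ _ hp).1)) ?_
  have h1 := hπ.dvd hp'
  have h2 : qd ∣ ρ₂ g p - ρ₂ g (π p) := by
    rw [← map_sub, ← qd_ρ g]; exact map_dvd _ (hπ.dvd hp)
  have := dvd_sub h2 h1
  rwa [sub_sub_sub_cancel_left] at this

theorem VV_SD4 {a b c d : ℕ} {p : R12} (hp : p ∈ VV a b c d) : p ∈ SD4 a b c d := hp.1.1

theorem famθ_equiv {a b c d e f : ℕ} {s t j : ℤ}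
    (hs : 3 * s = ((a : ℤ) + c - e) + 2 * ((b : ℤ) + d - f))
    (ht : 3 * t = ((a : ℤ) + c - e) - ((b : ℤ) + d - f)) (h0 : 0 ≤ t)
    {π : Module.End ℂ R12} (hπ : IsProj e f π) (hj : Jcond a b c d s t j) :
    IsEquivariantMap (VV a b c d) (V2 e f) ((famθ π s t j).domRestrict (VV a b c d)) := by
  constructor
  · intro w
    rw [LinearMap.domRestrict_apply, famθ_apply]
    exact (hπ _ (inner_SD2 hs ht h0 hj (VV_SD4 w.2))).1
  · intro g w hw
    rw [LinearMap.domRestrict_apply, LinearMap.domRestrict_apply, famθ_apply, famθ_apply, inner_ρ]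
    exact hπ.ρ_eq (inner_SD2 hs ht h0 hj (VV_SD4 w.2)) g

/-! ### The value of the maps at the cyclic vector -/

/-- monomials spanned by `e₁, x₁, x₂, x₃, e₃', x₁'` -/
def mn (A B C D : ℕ) : R12 := X (ev 0) ^ A * X (xv 2) ^ B * X (ep 2) ^ C * X (xp 0) ^ D

/-- monomials used after `μ_x` -/
def mn2 (A C P Q S : ℕ) : R12 :=
  X (ev 0) ^ A * X (ep 2) ^ C * (X (xv 0) ^ P * X (xv 1) ^ Q * X (xv 2) ^ S)

/-- monomials in the final target -/
def mn3 (A C P Q S : ℕ) : R12 :=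
  X (ev 0) ^ A * X (ev 2) ^ C * (X (xv 0) ^ P * X (xv 1) ^ Q * X (xv 2) ^ S)

theorem α_mn (A B C D : ℕ) : α (mn (A + 1) B C (D + 1)) = ((A + 1 : ℂ) * (D + 1)) • mn A B C D := by
  rw [α_apply, Fin.sum_univ_three]
  simp [mn, pderiv_mul, pderiv_X, pderiv_pow, Pi.single_apply, smul_eq_C_mul]
  ring

theorem β_mn (A B C D : ℕ) : β (mn A (B + 1) (C + 1) D) = ((B + 1 : ℂ) * (C + 1)) • mn A B C D := by
  rw [β_apply, Fin.sum_univ_three]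
  simp [mn, pderiv_mul, pderiv_X, pderiv_pow, Pi.single_apply, smul_eq_C_mul]
  ring

theorem θ_mn2 (A C P Q S : ℕ) : θ (mn2 (A + 1) (C + 1) P Q S) =
    (-((A + 1 : ℂ) * (C + 1))) • mn2 A C P (Q + 1) S := by
  rw [θ_apply, alt]
  simp [mn2, pderiv_mul, pderiv_X, pderiv_pow, Pi.single_apply, smul_eq_C_mul]
  ring

theorem ncast_ne (A D : ℕ) : ((A + 1 : ℂ) * (D + 1)) ≠ 0 :=
  mul_ne_zero (Nat.cast_add_one_ne_zero A) (Nat.cast_add_one_ne_zero D)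

theorem α_pow_mn (n A B C D : ℕ) : ∃ k : ℂ, k ≠ 0 ∧
    (α ^ n) (mn (A + n) B C (D + n)) = k • mn A B C D := by
  induction n with
  | zero => exact ⟨1, one_ne_zero, by simp⟩
  | succ n ih =>
    obtain ⟨k, hk, h⟩ := ih
    refine ⟨_, mul_ne_zero (ncast_ne (A + n) (D + n)) hk, ?_⟩
    rw [pow_succ, Module.End.mul_apply, ← add_assoc, ← add_assoc, α_mn, map_smul, h, smul_smul]

theorem β_pow_mn (n A B C D : ℕ) : ∃ k : ℂ, k ≠ 0 ∧
    (β ^ n) (mn A (B + n) (C + n) D) = k • mn A B C D := by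
  induction n with
  | zero => exact ⟨1, one_ne_zero, by simp⟩
  | succ n ih =>
    obtain ⟨k, hk, h⟩ := ih
    refine ⟨_, mul_ne_zero (ncast_ne (B + n) (C + n)) hk, ?_⟩
    rw [pow_succ, Module.End.mul_apply, ← add_assoc, ← add_assoc, β_mn, map_smul, h, smul_smul]

theorem θ_pow_mn2 (n A C P Q S : ℕ) : ∃ k : ℂ, k ≠ 0 ∧
    (θ ^ n) (mn2 (A + n) (C + n) P Q S) = k • mn2 A C P (Q + n) S := by
  induction n generalizing Q with
  | zero => exact ⟨1, one_ne_zero, by simp⟩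
  | succ n ih =>
    obtain ⟨k, hk, h⟩ := ih (Q + 1)
    refine ⟨_, mul_ne_zero (neg_ne_zero.mpr (ncast_ne (A + n) (C + n))) hk, ?_⟩
    rw [pow_succ, Module.End.mul_apply, ← add_assoc, ← add_assoc, θ_mn2, map_smul, h, smul_smul]
    rw [add_right_comm, add_assoc]

theorem μx_mn (A B C D : ℕ) : μx (mn A B C D) = mn2 A C D 0 B := by
  simp [mn, mn2]; ring

theorem κ_μe_mn2 (A C P Q S : ℕ) : κ (μe (mn2 A C P Q S)) = mn3 A C P (Q + A + C) S := by
  simp [mn3, mn2]; ring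

theorem value_aux (A B C D m j t : ℕ) : ∃ k : ℂ, k ≠ 0 ∧
    κ (μe ((θ ^ t) (μx ((β ^ j) ((α ^ m) (mn (A + t + m) (B + j) (C + t + j) (D + m))))))) =
      k • mn3 A C D (A + C + t) B := by
  obtain ⟨k1, h1, e1⟩ := α_pow_mn m (A + t) (B + j) (C + t + j) D
  obtain ⟨k2, h2, e2⟩ := β_pow_mn j (A + t) B (C + t) D
  obtain ⟨k3, h3, e3⟩ := θ_pow_mn2 t A C D 0 B
  refine ⟨k1 * (k2 * k3), mul_ne_zero h1 (mul_ne_zero h2 h3), ?_⟩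
  rw [e1, map_smul, e2]
  simp only [map_smul]
  rw [μx_mn, e3]
  simp only [map_smul, κ_μe_mn2, smul_smul]
  congr 2; ring

theorem inner_w0 {a b c d e f : ℕ} {s t j : ℤ}
    (hs : 3 * s = ((a : ℤ) + c - e) + 2 * ((b : ℤ) + d - f))
    (ht : 3 * t = ((a : ℤ) + c - e) - ((b : ℤ) + d - f)) (h0 : 0 ≤ t)
    (hj : Jcond a b c d s t j) : ∃ k : ℂ, k ≠ 0 ∧
    κ (inner s t j (mn a b c d)) = k • mn3 (a - s - t + j).toNat (c - t - j).toNat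
      (d - s + j).toNat (e + t).toNat (b - j).toNat := by
  obtain ⟨h1, h2, h3, h4, h5, h6, h7, h8, h9, h10⟩ := hj
  have := value_aux (a - s - t + j).toNat (b - j).toNat (c - t - j).toNat
      (d - s + j).toNat (s - j).toNat j.toNat t.toNat
  rw [inner_apply]
  have e1 : (a - s - t + j).toNat + t.toNat + (s - j).toNat = a := by omega
  have e2 : (b - j).toNat + j.toNat = b := by omega
  have e3 : (c - t - j).toNat + t.toNat + j.toNat = c := by omega
  have e4 : (d - s + j).toNat + (s - j).toNat = d := by omega
  have e5 : (a - s - t + j).toNat + (c - t - j).toNat + t.toNat = (e + t).toNat := by omega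
  rw [e1, e2, e3, e4, e5] at this
  exact this

theorem mn_mem (a b c d : ℕ) : mn a b c d ∈ VV a b c d := by
  rw [VV, Submodule.mem_inf, Submodule.mem_inf]
  refine ⟨⟨?_, ?_⟩, ?_⟩
  · rw [mem_SD4, mn]
    refine ⟨?_, ?_, ?_, ?_⟩
    · simpa using ((((wh_X wE (ev 0) (n := 1) (by simp [wE_eq])).pow a).mul
        ((wh_X wE (xv 2) (n := 0) (by simp [wE_eq])).pow b)).mul
        ((wh_X wE (ep 2) (n := 0) (by simp [wE_eq])).pow c)).mul
        ((wh_X wE (xp 0) (n := 0) (by simp [wE_eq])).pow d)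
    · simpa using ((((wh_X wX (ev 0) (n := 0) (by simp [wX_eq])).pow a).mul
        ((wh_X wX (xv 2) (n := 1) (by simp [wX_eq])).pow b)).mul
        ((wh_X wX (ep 2) (n := 0) (by simp [wX_eq])).pow c)).mul
        ((wh_X wX (xp 0) (n := 0) (by simp [wX_eq])).pow d)
    · simpa using ((((wh_X wEp (ev 0) (n := 0) (by simp [wEp_eq])).pow a).mul
        ((wh_X wEp (xv 2) (n := 0) (by simp [wEp_eq])).pow b)).mul
        ((wh_X wEp (ep 2) (n := 1) (by simp [wEp_eq])).pow c)).mul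
        ((wh_X wEp (xp 0) (n := 0) (by simp [wEp_eq])).pow d)
    · simpa using ((((wh_X wXp (ev 0) (n := 0) (by simp [wXp_eq])).pow a).mul
        ((wh_X wXp (xv 2) (n := 0) (by simp [wXp_eq])).pow b)).mul
        ((wh_X wXp (ep 2) (n := 0) (by simp [wXp_eq])).pow c)).mul
        ((wh_X wXp (xp 0) (n := 1) (by simp [wXp_eq])).pow d)
  · rw [LinearMap.mem_ker, Δ_apply, Fin.sum_univ_three]
    simp [mn, pderiv_mul, pderiv_X, pderiv_pow, Pi.single_apply]
  · rw [LinearMap.mem_ker, Δ'_apply, Fin.sum_univ_three]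
    simp [mn, pderiv_mul, pderiv_X, pderiv_pow, Pi.single_apply]

/-- the exponent vector of `mn3` -/
def ex3 (A C P Q S : ℕ) : Fin 12 →₀ ℕ :=
  Finsupp.equivFunOnFinite.symm (blk ![A, 0, C] ![P, Q, S] 0 0)

theorem mn3_eq (A C P Q S : ℕ) : mn3 A C P Q S = monomial (ex3 A C P Q S) 1 := by
  rw [monomial_eq, map_one, one_mul, Finsupp.prod_fintype _ _ (by simp)]
  have := fun F : Fin 12 → R12 => sum12 (A := Additive R12) F
  have h2 : ∀ F : Fin 12 → R12, ∏ k, F k = (∏ i, F (ev i)) * (∏ i, F (xv i)) * (∏ i, F (ep i)) *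
    ∏ i, F (xp i) := this
  rw [h2]
  simp [ex3, Fin.prod_univ_three, mn3]

theorem ex3_inj {A C P Q S A' C' P' Q' S' : ℕ} (h : ex3 A C P Q S = ex3 A' C' P' Q' S') :
    A = A' ∧ C = C' ∧ P = P' ∧ Q = Q' ∧ S = S' := by
  have h1 := DFunLike.congr_fun h (ev 0)
  have h2 := DFunLike.congr_fun h (ev 2)
  have h3 := DFunLike.congr_fun h (xv 0)
  have h4 := DFunLike.congr_fun h (xv 1)
  have h5 := DFunLike.congr_fun h (xv 2)
  simp [ex3] at h1 h2 h3 h4 h5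
  exact ⟨h1, h2, h3, h4, h5⟩

/-- the exponent of the monomial attached to `j` -/
def exJ (a b c d e : ℕ) (s t j : ℤ) : Fin 12 →₀ ℕ :=
  ex3 (a - s - t + j).toNat (c - t - j).toNat (d - s + j).toNat (e + t).toNat (b - j).toNat

/-- the vector `κ (ψ w₀)` as a linear function of `ψ` -/
def evw (a b c d : ℕ) : (VV a b c d →ₗ[ℂ] R12) →ₗ[ℂ] R12 :=
  κ.toLinearMap ∘ₗ LinearMap.applyₗ (⟨mn a b c d, mn_mem a b c d⟩ : VV a b c d)

theorem evw_apply (a b c d : ℕ) (ψ : VV a b c d →ₗ[ℂ] R12) :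
    evw a b c d ψ = κ (ψ ⟨mn a b c d, mn_mem a b c d⟩) := rfl

theorem evw_fam {a b c d e f : ℕ} {s t j : ℤ}
    (hs : 3 * s = ((a : ℤ) + c - e) + 2 * ((b : ℤ) + d - f))
    (ht : 3 * t = ((a : ℤ) + c - e) - ((b : ℤ) + d - f)) (h0 : 0 ≤ t)
    {π : Module.End ℂ R12} (hπ : IsProj e f π) (hj : Jcond a b c d s t j) : ∃ k : ℂ, k ≠ 0 ∧
    evw a b c d ((famθ π s t j).domRestrict (VV a b c d)) =
      k • monomial (exJ a b c d e s t j) 1 := by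
  obtain ⟨k, hk, h⟩ := inner_w0 hs ht h0 hj
  refine ⟨k, hk, ?_⟩
  rw [evw_apply, LinearMap.domRestrict_apply, famθ_apply,
    hπ.κ_eq (inner_SD2 hs ht h0 hj (VV_SD4 (mn_mem a b c d))), h, mn3_eq, exJ]

theorem famθ_indep {a b c d e f : ℕ} {s t : ℤ}
    (hs : 3 * s = ((a : ℤ) + c - e) + 2 * ((b : ℤ) + d - f))
    (ht : 3 * t = ((a : ℤ) + c - e) - ((b : ℤ) + d - f)) (h0 : 0 ≤ t)
    {π : Module.End ℂ R12} (hπ : IsProj e f π) :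
    LinearIndependent ℂ (fun j : {j : ℤ // Jcond a b c d s t j} =>
        (famθ π s t j.val).domRestrict (VV a b c d)) := by
  apply LinearIndependent.of_comp (evw a b c d)
  choose k hk h using fun j : {j : ℤ // Jcond a b c d s t j} => evw_fam hs ht h0 hπ j.2
  have h1 : LinearIndependent ℂ (fun j : {j : ℤ // Jcond a b c d s t j} =>
      (monomial (exJ a b c d e s t j.val) 1 : R12)) := by
    have h2 := (basisMonomials (Fin 12) ℂ).linearIndependent
    rw [coe_basisMonomials] at h2
    refine h2.comp (fun j : {j : ℤ // Jcond a b c d s t j} => exJ a b c d e s t j.val) ?_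
    intro j j' hjj
    have h5 := (ex3_inj hjj).2.2.2.2
    obtain ⟨j, g1, g2, g3, g4, g5, g6, g7, g8, g9, g10⟩ := j
    obtain ⟨j', g1', g2', g3', g4', g5', g6', g7', g8', g9', g10'⟩ := j'
    apply Subtype.ext
    simp only at h5 ⊢
    omega
  convert h1.units_smul (fun j => Units.mk0 (k j) (hk j)) using 1
  funext j
  exact h j

/-! ### The Fischer pairing -/

/-- factorial of an exponent vector -/
def mf (m : Fin 12 →₀ ℕ) : ℂ := ∏ k, ((m k).factorial : ℂ)

/-- the Fischer pairing -/
def BF : R12 →ₗ[ℂ] R12 →ₗ[ℂ] ℂ :=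
  (basisMonomials (Fin 12) ℂ).constr ℂ fun m => mf m • lcoeff ℂ m

theorem BF_apply (P Q : R12) : BF P Q = ∑ m ∈ P.support, coeff m P * (mf m * coeff m Q) := by
  rw [BF, Module.Basis.constr_apply]
  have : (basisMonomials (Fin 12) ℂ).repr P = AddMonoidAlgebra.coeff P := rfl
  rw [this, Finsupp.sum, LinearMap.sum_apply]
  rfl

/-- products of powers of linear forms -/
def KK (a b c d : ℕ) (y : Fin 12 → ℂ) : R12 :=
  (∑ i, C (y (ev i)) * X (ev i)) ^ a * (∑ i, C (y (xv i)) * X (xv i)) ^ b *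
  (∑ i, C (y (ep i)) * X (ep i)) ^ c * (∑ i, C (y (xp i)) * X (xp i)) ^ d

theorem KK_ev (a b c d : ℕ) (y : Fin 12 → ℂ) (i : Fin 3) :
    pderiv (ev i) (KK (a + 1) b c d y) = C ((a + 1 : ℂ) * y (ev i)) * KK a b c d y := by
  simp [KK, pderiv_X, Pi.single_apply]
  ring
theorem KK_xv (a b c d : ℕ) (y : Fin 12 → ℂ) (i : Fin 3) :
    pderiv (xv i) (KK a (b + 1) c d y) = C ((b + 1 : ℂ) * y (xv i)) * KK a b c d y := by
  simp [KK, pderiv_X, Pi.single_apply]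
  ring
theorem KK_ep (a b c d : ℕ) (y : Fin 12 → ℂ) (i : Fin 3) :
    pderiv (ep i) (KK a b (c + 1) d y) = C ((c + 1 : ℂ) * y (ep i)) * KK a b c d y := by
  simp [KK, pderiv_X, Pi.single_apply]
  ring
theorem KK_xp (a b c d : ℕ) (y : Fin 12 → ℂ) (i : Fin 3) :
    pderiv (xp i) (KK a b c (d + 1) y) = C ((d + 1 : ℂ) * y (xp i)) * KK a b c d y := by
  simp [KK, pderiv_X, Pi.single_apply]
  ring

theorem mf_add (m : Fin 12 →₀ ℕ) (k : Fin 12) :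
    mf (m + Finsupp.single k 1) = mf m * (m k + 1) := by
  have : ∀ l, ((((m + Finsupp.single k 1 : Fin 12 →₀ ℕ)) l).factorial : ℂ) =
      ((m l).factorial : ℂ) * (if l = k then (m k + 1 : ℂ) else 1) := by
    intro l
    by_cases h : l = k
    · subst h; simp [Nat.factorial_succ]; ring
    · simp [h, Finsupp.single_apply, Ne.symm h]
  simp only [mf, this, Finset.prod_mul_distrib, Finset.prod_ite_eq', Finset.mem_univ, if_true]

theorem yp_add (y : Fin 12 → ℂ) (m : Fin 12 →₀ ℕ) (k : Fin 12) :
    ∏ l, y l ^ ((m + Finsupp.single k 1 : Fin 12 →₀ ℕ) l) = (∏ l, y l ^ m l) * y k := by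
  have : ∀ l, y l ^ ((m + Finsupp.single k 1 : Fin 12 →₀ ℕ) l) = y l ^ m l * (if l = k then y k else 1) := by
    intro l
    by_cases h : l = k
    · subst h; simp [pow_succ]
    · simp [h, Finsupp.single_apply, Ne.symm h]
  simp only [this, Finset.prod_mul_distrib, Finset.prod_ite_eq', Finset.mem_univ, if_true]

theorem coeff_KK (y : Fin 12 → ℂ) (n : ℕ) : ∀ (m : Fin 12 →₀ ℕ) (a b c d : ℕ), m.degree = n →
    Finsupp.weight wE m = a → Finsupp.weight wX m = b → Finsupp.weight wEp m = c →
    Finsupp.weight wXp m = d →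
    mf m * coeff m (KK a b c d y) =
      ((a.factorial * b.factorial * c.factorial * d.factorial : ℕ) : ℂ) * ∏ l, y l ^ m l := by
  induction n with
  | zero =>
    intro m a b c d hm h1 h2 h3 h4
    rw [Finsupp.degree_eq_zero_iff] at hm
    subst hm
    simp at h1 h2 h3 h4
    subst h1 h2 h3 h4
    simp [mf, KK]
  | succ n ih =>
    intro m a b c d hm h1 h2 h3 h4
    have hne : m ≠ 0 := by rintro rfl; simp at hm
    obtain ⟨k, hk⟩ := Finsupp.support_nonempty_iff.mpr hne
    have hk1 : 1 ≤ m k := Nat.one_le_iff_ne_zero.mpr (Finsupp.mem_support_iff.mp hk)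
    obtain ⟨m, rfl⟩ : ∃ m', m = m' + Finsupp.single k 1 := 
      ⟨m - Finsupp.single k 1, (tsub_add_cancel_of_le (Finsupp.single_le_iff.mpr hk1)).symm⟩
    rw [map_add, Finsupp.degree_single] at hm
    have hm' : m.degree = n := by omega
    simp only [map_add, Finsupp.weight_single, one_smul] at h1 h2 h3 h4
    rw [mf_add, yp_add, mul_assoc, mul_comm ((m k : ℂ) + 1), ← coeff_pderiv]
    clear hk1 hk hne hm
    revert h1 h2 h3 h4
    revert k
    apply forall12 <;> intro i h1 h2 h3 h4 <;>
      simp only [wE_eq, wX_eq, wEp_eq, wXp_eq, blk_ev, blk_xv, blk_ep, blk_xp, Pi.one_apply,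
        Pi.zero_apply, add_zero] at h1 h2 h3 h4
    · subst h1
      rw [KK_ev, coeff_C_mul, mul_left_comm, ih m _ b c d hm' (by rw [wE_eq]) (by rw [wX_eq, h2])
        (by rw [wEp_eq, h3]) (by rw [wXp_eq, h4]), Nat.factorial_succ]
      push_cast; ring
    · subst h2
      rw [KK_xv, coeff_C_mul, mul_left_comm, ih m a _ c d hm' (by rw [wE_eq, h1]) (by rw [wX_eq])
        (by rw [wEp_eq, h3]) (by rw [wXp_eq, h4]), Nat.factorial_succ]
      push_cast; ring
    · subst h3
      rw [KK_ep, coeff_C_mul, mul_left_comm, ih m a b _ d hm' (by rw [wE_eq, h1])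
        (by rw [wX_eq, h2]) (by rw [wEp_eq]) (by rw [wXp_eq, h4]), Nat.factorial_succ]
      push_cast; ring
    · subst h4
      rw [KK_xp, coeff_C_mul, mul_left_comm, ih m a b c _ hm' (by rw [wE_eq, h1])
        (by rw [wX_eq, h2]) (by rw [wEp_eq, h3]) (by rw [wXp_eq]), Nat.factorial_succ]
      push_cast; ring

theorem BF_KK {a b c d : ℕ} {P : R12} (hP : P ∈ SD4 a b c d) (y : Fin 12 → ℂ) :
    BF P (KK a b c d y) =
      ((a.factorial * b.factorial * c.factorial * d.factorial : ℕ) : ℂ) * eval y P := by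
  rw [mem_SD4] at hP
  obtain ⟨h1, h2, h3, h4⟩ := hP
  rw [BF_apply, eval_eq', Finset.mul_sum]
  refine Finset.sum_congr rfl fun m hm => ?_
  have hm := mem_support_iff.mp hm
  rw [coeff_KK y _ m a b c d rfl (h1 hm) (h2 hm) (h3 hm) (h4 hm)]
  ring

theorem eval_zero_iff {a b c d : ℕ} {P : R12} (hP : P ∈ SD4 a b c d) (y : Fin 12 → ℂ) :
    eval y P = 0 ↔ BF P (KK a b c d y) = 0 := by
  rw [BF_KK hP]
  have : ((a.factorial * b.factorial * c.factorial * d.factorial : ℕ) : ℂ) ≠ 0 := by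
    have := Nat.factorial_ne_zero
    simp [this]
  rw [mul_eq_zero, or_iff_right this]

theorem KK_scale (a b c d : ℕ) (p q p' q' : Fin 3 → ℂ) (l m : ℂ) :
    KK a b c d (blk p (fun i => l * q i) p' (fun i => m * q' i)) =
      (l ^ b * m ^ d) • KK a b c d (blk p q p' q') := by
  simp only [KK, blk_ev, blk_xv, blk_ep, blk_xp, C_mul, mul_assoc, ← Finset.mul_sum, mul_pow,
    smul_eq_C_mul, C_pow]
  ring

theorem KK_ρ (a b c d : ℕ) (g : SL(3, ℂ)) : ρ₂ g (mn a b c d) = KK a b c d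
    (blk (fun i => g.val i 0) (fun i => (g⁻¹).val 2 i) (fun i => g.val i 2)
      (fun i => (g⁻¹).val 0 i)) := by
  simp only [mn, KK, map_mul, map_pow, ρ₂_ev, ρ₂_xv, ρ₂_ep, ρ₂_xp, blk_ev, blk_xv, blk_ep, blk_xp,
    smul_eq_C_mul]

/-! ### Vanishing on the orbit -/

theorem stepA {a b c d : ℕ} {P : R12} (hP : P ∈ SD4 a b c d)
    (h : ∀ g : SL(3, ℂ), BF P (ρ₂ g (mn a b c d)) = 0) (p q p' q' : Fin 3 → ℂ)
    (h1 : ∑ i, p i * q i = 0) (h2 : ∑ i, p' i * q' i = 0)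
    (h3 : ∑ i, p i * q' i ≠ 0) (h4 : ∑ i, p' i * q i ≠ 0) :
    eval (blk p q p' q') P = 0 := by
  rw [Fin.sum_univ_three] at h1 h2 h3 h4
  set u := p 0 * q' 0 + p 1 * q' 1 + p 2 * q' 2 with hu
  set v := p' 0 * q 0 + p' 1 * q 1 + p' 2 * q 2 with hv
  let cc : Fin 3 → ℂ := ![(q 1 * q' 2 - q 2 * q' 1) / (u * v), (q 2 * q' 0 - q 0 * q' 2) / (u * v),
    (q 0 * q' 1 - q 1 * q' 0) / (u * v)]
  let G : Matrix (Fin 3) (Fin 3) ℂ := !![p 0, cc 0, p' 0; p 1, cc 1, p' 1; p 2, cc 2, p' 2]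
  have hdet : G.det = 1 := by
    rw [Matrix.det_fin_three]
    simp [G, cc]
    field_simp
    rw [hu, hv]
    linear_combination (-(p' 0 * q' 0 + p' 1 * q' 1 + p' 2 * q' 2)) * h1
  let g : SL(3, ℂ) := ⟨G, hdet⟩
  have key := h g
  rw [KK_ρ] at key
  have e1 : (fun i => g.val i 0) = p := by funext i; fin_cases i <;> rfl
  have e2 : (fun i => g.val i 2) = p' := by funext i; fin_cases i <;> rfl
  have e3 : (fun i => (g⁻¹).val 2 i) = fun i => v⁻¹ * q i := by
    funext i
    rw [Matrix.SpecialLinearGroup.coe_inv]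
    simp only [g, G, Matrix.adjugate_fin_three_of]
    fin_cases i
    · simp [cc]; field_simp; rw [hu]; linear_combination (-q' 0) * h1
    · simp [cc]; field_simp; rw [hu]; linear_combination (-q' 1) * h1
    · simp [cc]; field_simp; rw [hu]; linear_combination (-q' 2) * h1
  have e4 : (fun i => (g⁻¹).val 0 i) = fun i => u⁻¹ * q' i := by
    funext i
    rw [Matrix.SpecialLinearGroup.coe_inv]
    simp only [g, G, Matrix.adjugate_fin_three_of]
    fin_cases i
    · simp [cc]; field_simp; rw [hv]; linear_combination (-q 0) * h2
    · simp [cc]; field_simp; rw [hv]; linear_combination (-q 1) * h2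
    · simp [cc]; field_simp; rw [hv]; linear_combination (-q 2) * h2
  rw [e1, e2, e3, e4, KK_scale, map_smul, smul_eq_mul, mul_eq_zero] at key
  rw [eval_zero_iff hP]
  exact key.resolve_left (mul_ne_zero (pow_ne_zero _ (inv_ne_zero h4)) (pow_ne_zero _ (inv_ne_zero h3)))

theorem cone_vanish {e f : ℕ} {F L : R12} (hF : F ∈ V2 e f) (hL : κ L ≠ 0)
    (h : ∀ z : Fin 12 → ℂ, ∑ i, z (ev i) * z (xv i) = 0 → eval z (F * L) = 0) : F = 0 := by
  apply V2_κ hF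
  have : κ (F * L) = 0 := by
    apply MvPolynomial.funext
    intro z
    rw [map_zero]
    have h1 : eval z (κ (F * L)) = eval (fun k => eval z (κ (X k))) (F * L) := by
      have : (aeval z).comp κ = aeval (fun k => (aeval z (κ (X k)) : ℂ)) := by
        apply MvPolynomial.algHom_ext; intro k
        rw [AlgHom.comp_apply, aeval_X]
      have := DFunLike.congr_fun this (F * L)
      rw [AlgHom.comp_apply] at this
      simpa only [aeval_eq_eval] using this
    rw [h1]
    apply h
    have := congrArg (eval z) κ_qd
    simpa [qd] using this
  rw [map_mul, mul_eq_zero] at this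
  exact this.resolve_right hL

theorem wh_C (w : Fin 12 → ℕ) {n : ℕ} (r : ℂ) (h : n = 0) :
    IsWeightedHomogeneous w (C r : R12) n := h ▸ isWeightedHomogeneous_C w r

theorem wh_zero {P : R12} : IsWeightedHomogeneous (0 : Fin 12 → ℕ) P 0 := by
  intro m _; simp [Finsupp.weight_apply]

theorem wh_sub1 {w w' : Fin 12 → ℕ} (u v : Fin 3 → ℂ) {n : ℕ} {P : R12}
    (h1 : ∀ i, w' (ev i) = w (ev i)) (h2 : ∀ i, w' (xv i) = w (xv i))
    (h3 : ∀ i, w (ep i) = 0) (h4 : ∀ i, w (xp i) = 0)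
    (hP : IsWeightedHomogeneous w P n) : IsWeightedHomogeneous w' (aeval (blk (fun i => (X (ev i) : R12)) (fun i => X (xv i)) (fun i => C (u i))
      (fun i => C (v i))) P) n := by
  refine wh_aeval (forall12 ?_ ?_ ?_ ?_) hP <;> intro i
  · rw [blk_ev]; exact wh_X _ _ (h1 i)
  · rw [blk_xv]; exact wh_X _ _ (h2 i)
  · rw [blk_ep]; exact wh_C _ _ (h3 i)
  · rw [blk_xp]; exact wh_C _ _ (h4 i)


theorem wh_sub2 {w w' : Fin 12 → ℕ} (u v : Fin 3 → ℂ) {n : ℕ} {P : R12}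
    (h1 : ∀ i, w (ev i) = 0) (h2 : ∀ i, w (xv i) = 0)
    (h3 : ∀ i, w' (ev i) = w (ep i)) (h4 : ∀ i, w' (xv i) = w (xp i))
    (hP : IsWeightedHomogeneous w P n) : IsWeightedHomogeneous w' (aeval (blk (fun i => (C (u i) : R12)) (fun i => C (v i)) (fun i => X (ev i))
      (fun i => X (xv i))) P) n := by
  refine wh_aeval (forall12 ?_ ?_ ?_ ?_) hP <;> intro i
  · rw [blk_ev]; exact wh_C _ _ (h1 i)
  · rw [blk_xv]; exact wh_C _ _ (h2 i)
  · rw [blk_ep]; exact wh_X _ _ (h3 i)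
  · rw [blk_xp]; exact wh_X _ _ (h4 i)


theorem VV_sub1 {a b c d : ℕ} {P : R12} (hP : P ∈ VV a b c d) (p' q' : Fin 3 → ℂ) :
    aeval (blk (fun i => (X (ev i) : R12)) (fun i => X (xv i)) (fun i => C (p' i))
      (fun i => C (q' i))) P ∈ V2 a b := by
  obtain ⟨⟨h1, h2⟩, -⟩ := hP
  obtain ⟨g1, g2, g3, g4⟩ := mem_SD4.mp h1
  rw [V2, Submodule.mem_inf]
  constructor
  · rw [LinearMap.mem_ker]
    have hh : Δ₂ P = 0 := h2
    rw [← map_zero (aeval (R := ℂ) (blk (fun i => (X (ev i) : R12)) (fun i => X (xv i))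
      (fun i => C (p' i)) (fun i => C (q' i)))), ← hh, Δ_apply, Δ_apply, map_sum]
    refine Finset.sum_congr rfl fun i _ => ?_
    rw [chain, sum12]
    simp [pderiv_X, Pi.single_apply, -aeval_eq_bind₁]
    rw [chain, sum12]
    simp [pderiv_X, Pi.single_apply, -aeval_eq_bind₁]
  · rw [SD2, mem_SD4]
    refine ⟨wh_sub1 _ _ ?_ ?_ ?_ ?_ g1, wh_sub1 _ _ ?_ ?_ ?_ ?_ g2,
      wh_sub1 (w := 0) _ _ ?_ ?_ ?_ ?_ wh_zero, wh_sub1 (w := 0) _ _ ?_ ?_ ?_ ?_ wh_zero⟩ <;>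
    · intro i
      simp [wE_eq, wX_eq, wEp_eq, wXp_eq]

theorem VV_sub2 {a b c d : ℕ} {P : R12} (hP : P ∈ VV a b c d) (p q : Fin 3 → ℂ) :
    aeval (blk (fun i => (C (p i) : R12)) (fun i => C (q i)) (fun i => X (ev i))
      (fun i => X (xv i))) P ∈ V2 c d := by
  obtain ⟨⟨h1, -⟩, h2⟩ := hP
  obtain ⟨g1, g2, g3, g4⟩ := mem_SD4.mp h1
  rw [V2, Submodule.mem_inf]
  constructor
  · rw [LinearMap.mem_ker]
    have hh : Δ₂' P = 0 := h2
    rw [← map_zero (aeval (R := ℂ) (blk (fun i => (C (p i) : R12)) (fun i => C (q i))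
      (fun i => X (ev i)) (fun i => X (xv i)))), ← hh, Δ_apply, Δ'_apply, map_sum]
    refine Finset.sum_congr rfl fun i _ => ?_
    rw [chain, sum12]
    simp [pderiv_X, Pi.single_apply, -aeval_eq_bind₁]
    rw [chain, sum12]
    simp [pderiv_X, Pi.single_apply, -aeval_eq_bind₁]
  · rw [SD2, mem_SD4]
    refine ⟨wh_sub2 _ _ ?_ ?_ ?_ ?_ g3, wh_sub2 _ _ ?_ ?_ ?_ ?_ g4,
      wh_sub2 (w := 0) _ _ ?_ ?_ ?_ ?_ wh_zero, wh_sub2 (w := 0) _ _ ?_ ?_ ?_ ?_ wh_zero⟩ <;>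
    · intro i
      simp [wE_eq, wX_eq, wEp_eq, wXp_eq]

theorem eval_sub (z : Fin 12 → ℂ) (F : Fin 12 → R12) (P : R12) :
    eval z (aeval F P) = eval (fun k => eval z (F k)) P := by
  have : (aeval z).comp (aeval F) = aeval (fun k => (aeval z (F k) : ℂ)) := by
    apply MvPolynomial.algHom_ext; intro k
    rw [AlgHom.comp_apply, aeval_X, aeval_X]
  have := DFunLike.congr_fun this P
  rw [AlgHom.comp_apply] at this
  simpa only [aeval_eq_eval] using this

theorem eval_sub1 (z : Fin 12 → ℂ) (P : R12) (p' q' : Fin 3 → ℂ) :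
    eval z (aeval (blk (fun i => (X (ev i) : R12)) (fun i => X (xv i)) (fun i => C (p' i))
      (fun i => C (q' i))) P) = eval (blk (fun i => z (ev i)) (fun i => z (xv i)) p' q') P := by
  rw [eval_sub]
  congr 2
  funext k; revert k; apply forall12 <;> intro i <;> simp

theorem eval_sub2 (z : Fin 12 → ℂ) (P : R12) (p q : Fin 3 → ℂ) :
    eval z (aeval (blk (fun i => (C (p i) : R12)) (fun i => C (q i)) (fun i => X (ev i))
      (fun i => X (xv i))) P) = eval (blk p q (fun i => z (ev i)) (fun i => z (xv i))) P := by
  rw [eval_sub]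
  congr 2
  funext k; revert k; apply forall12 <;> intro i <;> simp

theorem κ_lin_e (q : Fin 3 → ℂ) (hq : q ≠ 0) : κ (∑ i, C (q i) * X (ev i)) ≠ 0 := by
  intro h
  apply hq
  have h1 := congrArg (eval (blk ![1, 0, 0] ![0, 1, 0] 0 0)) h
  have h2 := congrArg (eval (blk ![0, 0, 1] ![0, 1, 0] 0 0)) h
  have h3 := congrArg (eval (blk ![1, 0, 0] ![1, 0, 0] 0 0)) h
  have hC : ∀ r : ℂ, κ (C r) = C r := fun r => κ.commutes r
  simp [Fin.sum_univ_three, hC] at h1 h2 h3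
  funext i; fin_cases i <;> simp [*]

theorem κ_lin_x (q : Fin 3 → ℂ) (hq : q ≠ 0) : κ (∑ i, C (q i) * X (xv i)) ≠ 0 := by
  intro h
  apply hq
  have h1 := congrArg (eval (blk 0 ![1, 0, 0] 0 0)) h
  have h2 := congrArg (eval (blk 0 ![0, 1, 0] 0 0)) h
  have h3 := congrArg (eval (blk 0 ![0, 0, 1] 0 0)) h
  have hC : ∀ r : ℂ, κ (C r) = C r := fun r => κ.commutes r
  simp [Fin.sum_univ_three, hC] at h1 h2 h3
  funext i; fin_cases i <;> simp [*]

theorem stepB {a b c d : ℕ} {P : R12} (hP : P ∈ VV a b c d)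
    (h : ∀ g : SL(3, ℂ), BF P (ρ₂ g (mn a b c d)) = 0) (p q p' q' : Fin 3 → ℂ)
    (h2 : ∑ i, p' i * q' i = 0) (hp : p' ≠ 0) (hq : q' ≠ 0) :
    eval (blk p q p' q') P = 0 := by
  have := cone_vanish (VV_sub1 hP p' q')
    (L := (∑ i, C (q' i) * X (ev i)) * (∑ i, C (p' i) * X (xv i)))
    (by rw [map_mul]; exact mul_ne_zero (κ_lin_e _ hq) (κ_lin_x _ hp))
    (by
      intro z hz
      rw [map_mul, eval_sub1, map_mul]
      by_cases h3 : ∑ i, z (ev i) * q' i = 0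
      · have : eval z (∑ i, C (q' i) * X (ev i)) = 0 := by
          rw [← h3]; simp [mul_comm]
        rw [this]; ring
      by_cases h4 : ∑ i, p' i * z (xv i) = 0
      · have : eval z (∑ i, C (p' i) * X (xv i)) = 0 := by
          rw [← h4]; simp
        rw [this]; ring
      rw [stepA (VV_SD4 hP) h _ _ _ _ hz h2 h3 h4, zero_mul])
  have h5 := eval_sub1 (blk p q p' q') P p' q'
  rw [this, map_zero] at h5
  simpa using h5.symm

theorem stepC {a b c d : ℕ} {P : R12} (hP : P ∈ VV a b c d)
    (h : ∀ g : SL(3, ℂ), BF P (ρ₂ g (mn a b c d)) = 0) : P = 0 := by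
  apply MvPolynomial.funext
  intro y
  rw [map_zero]
  have := cone_vanish (VV_sub2 hP (fun i => y (ev i)) (fun i => y (xv i)))
    (L := X (ev 0) * X (xv 1))
    (by
      rw [map_mul, κ_ev0, κ_xv]
      exact mul_ne_zero (mul_ne_zero (X_ne_zero _) (X_ne_zero _)) (X_ne_zero _))
    (by
      intro z hz
      rw [map_mul, eval_sub2, map_mul, eval_X, eval_X]
      by_cases h3 : z (ev 0) = 0
      · rw [h3]; ring
      by_cases h4 : z (xv 1) = 0
      · rw [h4]; ring
      rw [stepB hP h _ _ _ _ hz (fun h0 => h3 (congrFun h0 0)) (fun h0 => h4 (congrFun h0 1)),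
        zero_mul])
  have h5 := eval_sub2 (blk (fun i => y (ep i)) (fun i => y (xp i)) 0 0) P
    (fun i => y (ev i)) (fun i => y (xv i))
  rw [this, map_zero] at h5
  rw [h5]
  congr 2
  funext k; revert k; apply forall12 <;> intro i <;> simp

theorem Δ'_ρ (g : SL(3, ℂ)) (p : R12) : Δ₂' (ρ₂ g p) = ρ₂ g (Δ₂' p) := by
  simp only [Δ'_apply, pd_xp_ρ, map_sum, Derivation.map_smul, pd_ep_ρ]
  exact contr1 g fun i k => ρ₂ g (pderiv (ep i) (pderiv (xp k) p))

theorem VV_ρ' (g : SL(3, ℂ)) {a b c d : ℕ} {p : R12} (hp : p ∈ VV a b c d) :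
    ρ₂ g p ∈ VV a b c d := by
  obtain ⟨⟨h1, h2⟩, h3⟩ := hp
  rw [VV, Submodule.mem_inf, Submodule.mem_inf]
  refine ⟨⟨SD4_ρ g h1, ?_⟩, ?_⟩
  · have : Δ₂ p = 0 := h2
    simp [LinearMap.mem_ker, Δ_ρ, this]
  · have : Δ₂' p = 0 := h3
    simp [LinearMap.mem_ker, Δ'_ρ, this]

theorem VV_ρ (g : SL(3, ℂ)) {a b c d : ℕ} : ρ₂ g (mn a b c d) ∈ VV a b c d :=
  VV_ρ' g (mn_mem a b c d)

theorem VV_finite (a b c d : ℕ) : Module.Finite ℂ (VV a b c d) := by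
  have hle : VV a b c d ≤ restrictTotalDegree (Fin 12) ℂ (a + b + c + d) := by
    intro p hp
    obtain ⟨h1, h2, h3, h4⟩ := mem_SD4.mp (VV_SD4 hp)
    rw [mem_restrictTotalDegree, totalDegree, Finset.sup_le_iff]
    intro m hm
    have hm := mem_support_iff.mp hm
    rw [← wh_add (wh_add (wh_add h1 h2) h3) h4 hm, Finsupp.weight_apply]
    refine le_of_eq (Finset.sum_congr rfl fun k _ => ?_)
    revert k
    apply forall12 <;> intro i <;> simp [wE_eq, wX_eq, wEp_eq, wXp_eq]
  exact Module.Finite.of_injective _ (Submodule.inclusion_injective hle)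

theorem generation {a b c d : ℕ} (ψ : VV a b c d →ₗ[ℂ] R12)
    (h : ∀ g : SL(3, ℂ), ψ ⟨ρ₂ g (mn a b c d), VV_ρ g⟩ = 0) : ψ = 0 := by
  by_contra hne
  have hfin : Module.Finite ℂ (VV a b c d) := VV_finite a b c d
  have hlt : Module.finrank ℂ (LinearMap.ker ψ →ₗ[ℂ] ℂ) < Module.finrank ℂ (VV a b c d) := by
    refine (Subspace.dual_finrank_eq (K := ℂ) (V := LinearMap.ker ψ)).trans_lt ?_
    exact Submodule.finrank_lt (fun h => hne (LinearMap.ker_eq_top.mp h))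
  let T : VV a b c d →ₗ[ℂ] (LinearMap.ker ψ →ₗ[ℂ] ℂ) :=
    LinearMap.lcomp ℂ ℂ ((VV a b c d).subtype ∘ₗ (LinearMap.ker ψ).subtype) ∘ₗ BF ∘ₗ
      (VV a b c d).subtype
  obtain ⟨P, hP, hP0⟩ := (Submodule.ne_bot_iff _).mp (LinearMap.ker_ne_bot_of_finrank_lt (f := T) hlt)
  apply hP0
  apply Subtype.ext
  refine stepC P.2 fun g => ?_
  have : T P = 0 := hP
  exact DFunLike.congr_fun this ⟨⟨ρ₂ g (mn a b c d), VV_ρ g⟩, h g⟩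

/-! ### Torus weights -/

theorem zpow_sum_aux (W : Fin 12 → ℤ) (m : Fin 12 →₀ ℕ) (S : Finset (Fin 12)) :
    ∏ k ∈ S, ((2 : ℂ) ^ W k) ^ m k = (2 : ℂ) ^ (∑ k ∈ S, m k • W k) := by
  induction S using Finset.induction_on with
  | empty => simp
  | insert k S hk ih =>
    rw [Finset.prod_insert hk, Finset.sum_insert hk, ih, zpow_add₀ two_ne_zero, nsmul_eq_mul,
      mul_comm (m k : ℤ), zpow_mul, zpow_natCast]

theorem coeff_torus (F : R12 →ₐ[ℂ] R12) (W : Fin 12 → ℤ)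
    (hF : ∀ k, F (X k) = C ((2 : ℂ) ^ W k) * X k) (m : Fin 12 →₀ ℕ) (p : R12) :
    coeff m (F p) = (2 : ℂ) ^ (Finsupp.weight W m) * coeff m p := by
  induction p using MvPolynomial.induction_on' with
  | add p q hp hq => rw [map_add, coeff_add, coeff_add, hp, hq, mul_add]
  | monomial m' r =>
    have h1 : F (monomial m' r) = C ((2 : ℂ) ^ (Finsupp.weight W m')) * monomial m' r := by
      rw [monomial_eq, map_mul, algHom_C, Finsupp.prod, map_prod, Finsupp.weight_apply, Finsupp.sum,
        ← zpow_sum_aux]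
      simp only [map_pow, hF, mul_pow, Finset.prod_mul_distrib, map_prod, algebraMap_eq]
      ring
    rw [h1, coeff_C_mul]
    by_cases h : m' = m
    · rw [h]
    · rw [coeff_monomial, if_neg h, mul_zero, mul_zero]

/-- a torus element -/
def gD (n : Fin 3 → ℤ) (hn : ∑ i, n i = 0) : SL(3, ℂ) :=
  ⟨Matrix.diagonal fun i => (2 : ℂ) ^ n i, by
    rw [Fin.sum_univ_three] at hn
    rw [Matrix.det_diagonal, Fin.prod_univ_three, ← zpow_add₀ two_ne_zero,
      ← zpow_add₀ two_ne_zero, hn, zpow_zero]⟩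

theorem gD_inv (n : Fin 3 → ℤ) (hn : ∑ i, n i = 0) :
    (gD n hn)⁻¹ = gD (-n) (by simp [hn]) := by
  apply inv_eq_of_mul_eq_one_right
  apply Subtype.ext
  change Matrix.diagonal _ * Matrix.diagonal _ = 1
  rw [Matrix.diagonal_mul_diagonal, ← Matrix.diagonal_one]
  congr 1
  funext i
  rw [Pi.neg_apply, ← zpow_add₀ two_ne_zero, add_neg_cancel, zpow_zero]

theorem gD_ρ (n : Fin 3 → ℤ) (hn : ∑ i, n i = 0) (k : Fin 12) :
    ρ₂ (gD n hn) (X k) = C ((2 : ℂ) ^ (blk n (-n) n (-n) k)) * X k := by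
  revert k
  apply forall12 <;> intro i
  · rw [ρ₂_ev, blk_ev, Finset.sum_eq_single i] <;> simp +contextual [gD, smul_eq_C_mul]
  · rw [ρ₂_xv, blk_xv, gD_inv, Finset.sum_eq_single i] <;>
      simp +contextual [gD, smul_eq_C_mul, Matrix.diagonal_apply, eq_comm]
  · rw [ρ₂_ep, blk_ep, Finset.sum_eq_single i] <;> simp +contextual [gD, smul_eq_C_mul]
  · rw [ρ₂_xp, blk_xp, gD_inv, Finset.sum_eq_single i] <;>
      simp +contextual [gD, smul_eq_C_mul, Matrix.diagonal_apply, eq_comm]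

theorem gD_mn (n : Fin 3 → ℤ) (hn : ∑ i, n i = 0) (a b c d : ℕ) :
    ρ₂ (gD n hn) (mn a b c d) = (2 : ℂ) ^ (a * n 0 - b * n 2 + c * n 2 - d * n 0) •
      mn a b c d := by
  simp only [mn, map_mul, map_pow, gD_ρ, blk_ev, blk_xv, blk_ep, blk_xp, mul_pow, smul_eq_C_mul]
  have : (2 : ℂ) ^ (a * n 0 - b * n 2 + c * n 2 - d * n 0) =
      (2 ^ (n 0)) ^ a * (2 ^ ((-n) 2)) ^ b * (2 ^ (n 2)) ^ c * (2 ^ ((-n) 0)) ^ d := by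
    simp only [← zpow_natCast, ← zpow_mul, ← zpow_add₀ (two_ne_zero (α := ℂ)), Pi.neg_apply]
    congr 1; ring
  rw [this]
  simp only [C_mul, C_pow]
  ring

theorem torus_wh {n : Fin 3 → ℤ} {hn : ∑ i, n i = 0} {N : ℤ} {u : R12}
    (h : ρ₂ (gD n hn) u = (2 : ℂ) ^ N • u) : IsWeightedHomogeneous (blk n (-n) n (-n)) u N := by
  intro m hm
  have h1 := coeff_torus _ _ (gD_ρ n hn) m u
  rw [h, coeff_smul, smul_eq_mul] at h1
  have h2 := mul_right_cancel₀ hm h1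
  have h4 : (2 : ℝ) ^ N = (2 : ℝ) ^ (Finsupp.weight (blk n (-n) n (-n)) m) := by
    apply Complex.ofReal_injective
    rw [Complex.ofReal_zpow, Complex.ofReal_zpow, Complex.ofReal_ofNat]
    exact h2
  exact (zpow_right_injective₀ (by norm_num) (by norm_num) h4).symm

theorem wh_κ {w : Fin 12 → ℤ} {N : ℤ} {u : R12} (h : IsWeightedHomogeneous w u N)
    (h1 : w (ev 0) + w (xv 0) = w (ev 1) + w (xv 1))
    (h2 : w (ev 2) + w (xv 2) = w (ev 1) + w (xv 1)) (z : ℤ) :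
    IsWeightedHomogeneous (blk ![w (ev 0) - w (xv 1), z, w (ev 2) - w (xv 1)]
      (fun i => w (xv i)) (fun i => w (ep i)) (fun i => w (xp i))) (κ u) N := by
  rw [κ]
  refine wh_aeval (forall12 ?_ ?_ ?_ ?_) h <;> intro i <;>
    simp only [blk_ev, blk_xv, blk_ep, blk_xp]
  · fin_cases i
    · have := (wh_X (blk ![w (ev 0) - w (xv 1), z, w (ev 2) - w (xv 1)]
        (fun i => w (xv i)) (fun i => w (ep i)) (fun i => w (xp i))) (ev 0) (by simp; rfl)).mul
        (wh_X _ (xv 1) (by simp; rfl))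
      simpa using this
    · have e1 := (wh_X (blk ![w (ev 0) - w (xv 1), z, w (ev 2) - w (xv 1)]
        (fun i => w (xv i)) (fun i => w (ep i)) (fun i => w (xp i))) (ev 0) (by simp; rfl)).mul
        (wh_X _ (xv 0) (by simp; rfl))
      have e2 := (wh_X (blk ![w (ev 0) - w (xv 1), z, w (ev 2) - w (xv 1)]
        (fun i => w (xv i)) (fun i => w (ep i)) (fun i => w (xp i))) (ev 2) (by simp; rfl)).mul
        (wh_X _ (xv 2) (by simp; rfl))
      rw [show w (ev 0) - w (xv 1) + w (xv 0) = w (ev 1) by omega] at e1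
      rw [show w (ev 2) - w (xv 1) + w (xv 2) = w (ev 1) by omega] at e2
      have := wh_smul (-1) (e2.add e1)
      simpa using this
    · have := (wh_X (blk ![w (ev 0) - w (xv 1), z, w (ev 2) - w (xv 1)]
        (fun i => w (xv i)) (fun i => w (ep i)) (fun i => w (xp i))) (ev 2) (by simp; rfl)).mul
        (wh_X _ (xv 1) (by simp; rfl))
      simpa using this
  · exact wh_X _ _ (by simp)
  · exact wh_X _ _ (by simp)
  · exact wh_X _ _ (by simp)

theorem weight12 (w : Fin 12 → ℤ) (m : Fin 12 →₀ ℕ) : Finsupp.weight w m =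
    ∑ i, m (ev i) * w (ev i) + ∑ i, m (xv i) * w (xv i) + ∑ i, m (ep i) * w (ep i) +
      ∑ i, m (xp i) * w (xp i) := by
  rw [Finsupp.weight_apply, Finsupp.sum_fintype _ _ (by simp), sum12]
  simp only [nsmul_eq_mul]

theorem wh_int {w : Fin 12 → ℕ} {n : ℕ} {p : R12} (h : IsWeightedHomogeneous w p n) :
    IsWeightedHomogeneous (fun k => (w k : ℤ)) p (n : ℤ) := by
  simpa using wh_map (Nat.castAddMonoidHom ℤ) h

theorem equiv_w0 {a b c d e f : ℕ} {φ : VV a b c d →ₗ[ℂ] R12}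
    (hφ : IsEquivariantMap (VV a b c d) (V2 e f) φ) (g : SL(3, ℂ)) :
    φ ⟨ρ₂ g (mn a b c d), VV_ρ g⟩ = ρ₂ g (φ ⟨mn a b c d, mn_mem a b c d⟩) :=
  hφ.2 g ⟨mn a b c d, mn_mem a b c d⟩ (VV_ρ g)

theorem equiv_torus {a b c d e f : ℕ} {φ : VV a b c d →ₗ[ℂ] R12}
    (hφ : IsEquivariantMap (VV a b c d) (V2 e f) φ) (n : Fin 3 → ℤ) (hn : ∑ i, n i = 0) :
    IsWeightedHomogeneous (blk n (-n) n (-n)) (φ ⟨mn a b c d, mn_mem a b c d⟩)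
      (a * n 0 - b * n 2 + c * n 2 - d * n 0) := by
  apply torus_wh (hn := hn)
  rw [← equiv_w0 hφ, ← map_smul]
  congr 1
  apply Subtype.ext
  exact gD_mn n hn a b c d

theorem supp_v {a b c d e f : ℕ} {φ : VV a b c d →ₗ[ℂ] R12}
    (hφ : IsEquivariantMap (VV a b c d) (V2 e f) φ) {m : Fin 12 →₀ ℕ}
    (hm : coeff m (evw a b c d φ) ≠ 0) :
    m (ev 1) = 0 ∧ m (ev 0) + m (ev 2) = e ∧
      m (xv 0) + m (xv 1) + m (xv 2) = f + m (ev 0) + m (ev 2) ∧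
      (m (xv 1) : ℤ) - m (xv 0) - m (ev 2) = a - d ∧
      (m (xv 1) : ℤ) - m (xv 2) - m (ev 0) = c - b ∧
      (∀ i, m (ep i) = 0) ∧ (∀ i, m (xp i) = 0) := by
  rw [evw_apply] at hm
  have hu := hφ.1 ⟨mn a b c d, mn_mem a b c d⟩
  obtain ⟨h1, h2, h3, h4⟩ := mem_SD4.1 hu.2
  have k1 := wh_κ (wh_int h1) (by simp [wE_eq]) (by simp [wE_eq]) 0 hm
  have k1' := wh_κ (wh_int h1) (by simp [wE_eq]) (by simp [wE_eq]) 1 hm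
  have k2 := wh_κ (wh_int h2) (by simp [wX_eq]) (by simp [wX_eq]) 0 hm
  have k3 := wh_κ (wh_int h3) (by simp [wEp_eq]) (by simp [wEp_eq]) 0 hm
  have k4 := wh_κ (wh_int h4) (by simp [wXp_eq]) (by simp [wXp_eq]) 0 hm
  have k5 := wh_κ (equiv_torus hφ ![1, -1, 0] (by simp [Fin.sum_univ_three])) (by simp) (by simp)
    0 hm
  have k6 := wh_κ (equiv_torus hφ ![0, -1, 1] (by simp [Fin.sum_univ_three])) (by simp) (by simp)
    0 hm
  rw [weight12] at k1 k1' k2 k3 k4 k5 k6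
  simp [wE_eq, wX_eq, wEp_eq, wXp_eq, Fin.sum_univ_three] at k1 k1' k2 k3 k4 k5 k6
  refine ⟨by omega, by omega, by omega, by omega, by omega, ?_, ?_⟩ <;>
    simp only [Fin.forall_fin_succ, Fin.forall_fin_zero_pi, Fin.succ_zero_eq_one,
      Fin.succ_one_eq_two, IsEmpty.forall_iff, and_true] <;>
    omega

/-- degree bound from polynomial dependence on a parameter -/
theorem deg_bound {v : R12} {k0 : Fin 12} {N : ℕ} {cf : ℕ → ℂ}
    (hinj : ∀ m m', coeff m v ≠ 0 → coeff m' v ≠ 0 → m k0 = m' k0 → m = m')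
    (z : Fin 12 → ℂ) (hz0 : z k0 = 1)
    (hz : ∀ m, coeff m v ≠ 0 → ∏ k, z k ^ m k = 1)
    (h : ∀ r : ℂ, eval (fun k => if k = k0 then r else z k) v =
      ∑ k ∈ Finset.range (N + 1), r ^ k * cf k) {m : Fin 12 →₀ ℕ} (hm : coeff m v ≠ 0) :
    m k0 ≤ N := by
  have hmon : ∀ m, coeff m v ≠ 0 → ∀ r : ℂ,
      ∏ k, (if k = k0 then r else z k) ^ m k = r ^ m k0 := by
    intro m hm r
    have h1 := hz m hm
    rw [← Finset.mul_prod_erase _ _ (Finset.mem_univ k0)] at h1 ⊢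
    rw [hz0, one_pow, one_mul] at h1
    rw [if_pos rfl]
    have : ∏ x ∈ Finset.univ.erase k0, (if x = k0 then r else z x) ^ m x =
        ∏ x ∈ Finset.univ.erase k0, z x ^ m x :=
      Finset.prod_congr rfl fun x hx => by rw [if_neg (Finset.ne_of_mem_erase hx)]
    rw [this, h1, mul_one]
  have hpoly : (∑ m ∈ v.support, Polynomial.monomial (m k0) (coeff m v)) =
      ∑ k ∈ Finset.range (N + 1), Polynomial.monomial k (cf k) := by
    apply Polynomial.funext
    intro r
    simp only [Polynomial.eval_finset_sum, Polynomial.eval_monomial]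
    have h2 := h r
    rw [eval_eq'] at h2
    rw [show (∑ k ∈ Finset.range (N + 1), cf k * r ^ k) =
      ∑ k ∈ Finset.range (N + 1), r ^ k * cf k from Finset.sum_congr rfl fun _ _ => mul_comm _ _,
      ← h2]
    refine Finset.sum_congr rfl fun m hm => ?_
    rw [hmon m (mem_support_iff.1 hm)]
  by_contra hlt
  have h3 := congrArg (Polynomial.coeff · (m k0)) hpoly
  simp only [Polynomial.finset_sum_coeff, Polynomial.coeff_monomial] at h3
  rw [Finset.sum_eq_single m, if_pos rfl, Finset.sum_eq_zero] at h3
  · exact hm h3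
  · intro k hk
    rw [if_neg]
    have := Finset.mem_range.1 hk
    omega
  · intro m' hm' hne
    rw [if_neg]
    intro he
    exact hne (hinj _ _ (mem_support_iff.1 hm') hm he)
  · intro hn
    exact absurd (notMem_support_iff.1 hn) hm

/-- transvection -/
def gT (i : Fin 3) (hi : i ≠ 1) (r : ℂ) : SL(3, ℂ) :=
  ⟨Matrix.transvection i 1 (-r), Matrix.det_transvection_of_ne _ _ hi _⟩

theorem gT_inv (i : Fin 3) (hi : i ≠ 1) (r : ℂ) : (gT i hi r)⁻¹ = gT i hi (-r) := by
  apply inv_eq_of_mul_eq_one_right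
  apply Subtype.ext
  change Matrix.transvection _ _ _ * Matrix.transvection _ _ _ = 1
  rw [Matrix.transvection_mul_transvection_same _ _ hi]
  simp

theorem gT_xv (i : Fin 3) (hi : i ≠ 1) (r : ℂ) (k : Fin 3) :
    ρ₂ (gT i hi r) (X (xv k)) = X (xv k) + (if k = i then C r * X (xv 1) else 0) := by
  rw [ρ₂_xv, gT_inv]
  fin_cases i <;> fin_cases k <;>
    simp [gT, Matrix.transvection, Matrix.single, Fin.sum_univ_three, smul_eq_C_mul, Matrix.one_apply] at hi ⊢
  all_goals ring

theorem gT_xp (i : Fin 3) (hi : i ≠ 1) (r : ℂ) (k : Fin 3) :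
    ρ₂ (gT i hi r) (X (xp k)) = X (xp k) + (if k = i then C r * X (xp 1) else 0) := by
  rw [ρ₂_xp, gT_inv]
  fin_cases i <;> fin_cases k <;>
    simp [gT, Matrix.transvection, Matrix.single, Fin.sum_univ_three, smul_eq_C_mul, Matrix.one_apply] at hi ⊢
  all_goals ring

theorem gT_ev (i : Fin 3) (hi : i ≠ 1) (r : ℂ) (k : Fin 3) :
    ρ₂ (gT i hi r) (X (ev k)) = X (ev k) - (if k = 1 then C r * X (ev i) else 0) := by
  rw [ρ₂_ev]
  fin_cases i <;> fin_cases k <;>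
    simp [gT, Matrix.transvection, Matrix.single, Fin.sum_univ_three, smul_eq_C_mul, Matrix.one_apply] at hi ⊢
  all_goals ring

theorem gT_ep (i : Fin 3) (hi : i ≠ 1) (r : ℂ) (k : Fin 3) :
    ρ₂ (gT i hi r) (X (ep k)) = X (ep k) - (if k = 1 then C r * X (ep i) else 0) := by
  rw [ρ₂_ep]
  fin_cases i <;> fin_cases k <;>
    simp [gT, Matrix.transvection, Matrix.single, Fin.sum_univ_three, smul_eq_C_mul, Matrix.one_apply] at hi ⊢
  all_goals ring

/-- evaluation point -/
def zr (i : Fin 3) (r : ℂ) : Fin 12 → ℂ := blk 1 (fun k => if k = i then r else 1) 0 0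

theorem eval_κ_gT (i : Fin 3) (hi : i ≠ 1) (r : ℂ) (u : R12) :
    eval (zr i 0) (κ (ρ₂ (gT i hi r) u)) = eval (zr i r) (κ u) := by
  have : ((aeval (zr i 0)).comp (κ.comp (ρ₂ (gT i hi r))) : R12 →ₐ[ℂ] ℂ) =
      (aeval (zr i r)).comp κ := by
    apply algHom_ext
    apply forall12 <;> intro k <;>
      simp only [AlgHom.comp_apply, gT_ev, gT_xv, gT_ep, gT_xp]
    all_goals
      fin_cases i <;> fin_cases k <;>
        simp [zr, algHom_C, -aeval_eq_bind₁] at hi ⊢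
    all_goals ring
  exact DFunLike.congr_fun this u

theorem w0_expand2 (a b c d : ℕ) (r : ℂ) : ρ₂ (gT 2 (by decide) r) (mn a b c d) =
    ∑ k ∈ Finset.range (b + 1), r ^ k • (X (ev 0) ^ a * (X (xv 1) ^ k * X (xv 2) ^ (b - k) *
      (b.choose k : R12)) * X (ep 2) ^ c * X (xp 0) ^ d) := by
  simp only [mn, map_mul, map_pow, gT_ev, gT_xv, gT_ep, gT_xp]
  simp only [if_true, sub_zero, add_zero, Fin.reduceEq, if_false]
  rw [add_comm (X (xv 2)), add_pow, Finset.mul_sum, Finset.sum_mul, Finset.sum_mul]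
  refine Finset.sum_congr rfl fun k _ => ?_
  rw [smul_eq_C_mul, mul_pow, C_pow]
  ring

theorem w0_expand0 (a b c d : ℕ) (r : ℂ) : ρ₂ (gT 0 (by decide) r) (mn a b c d) =
    ∑ k ∈ Finset.range (d + 1), r ^ k • (X (ev 0) ^ a * X (xv 2) ^ b * X (ep 2) ^ c *
      (X (xp 1) ^ k * X (xp 0) ^ (d - k) * (d.choose k : R12))) := by
  simp only [mn, map_mul, map_pow, gT_ev, gT_xv, gT_ep, gT_xp]
  simp only [if_true, sub_zero, add_zero, Fin.reduceEq, if_false]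
  rw [add_comm (X (xp 0)), add_pow, Finset.mul_sum]
  refine Finset.sum_congr rfl fun k _ => ?_
  rw [smul_eq_C_mul, mul_pow, C_pow]
  ring

theorem bound_aux {a b c d e f : ℕ} {φ : VV a b c d →ₗ[ℂ] R12}
    (hφ : IsEquivariantMap (VV a b c d) (V2 e f) φ) (i : Fin 3) (hi : i ≠ 1) (N : ℕ)
    (wk : ℕ → R12) (hw : ∀ r : ℂ, ρ₂ (gT i hi r) (mn a b c d) =
      ∑ k ∈ Finset.range (N + 1), r ^ k • wk k)
    {m : Fin 12 →₀ ℕ} (hm : coeff m (evw a b c d φ) ≠ 0) : m (xv i) ≤ N := by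
  obtain ⟨Φ, hΦ⟩ := LinearMap.exists_extend φ
  have hΦ' : ∀ w : VV a b c d, Φ w = φ w := fun w => by rw [← hΦ]; rfl
  refine deg_bound (cf := fun k => eval (zr i 0) (κ (Φ (wk k)))) ?_ (blk 1 1 0 0) (by simp) ?_ ?_ hm
  · intro m m' hm hm' he
    obtain ⟨a1, a2, a3, a4, a5, a6, a7⟩ := supp_v hφ hm
    obtain ⟨b1, b2, b3, b4, b5, b6, b7⟩ := supp_v hφ hm'
    ext k
    revert k
    apply forall12 <;> intro k
    · fin_cases i <;> fin_cases k <;> simp at hi he ⊢ <;> omega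
    · fin_cases i <;> fin_cases k <;> simp at hi he ⊢ <;> omega
    · rw [a6, b6]
    · rw [a7, b7]
  · intro m hm
    obtain ⟨a1, a2, a3, a4, a5, a6, a7⟩ := supp_v hφ hm
    apply Finset.prod_eq_one
    intro k _
    revert k
    apply forall12 <;> intro k <;> simp [a6, a7]
  · intro r
    have h1 : (fun k => if k = xv i then r else blk 1 1 0 0 k) = zr i r := by
      funext k
      revert k
      apply forall12 <;> intro k <;> simp [zr]
    rw [h1, evw_apply, ← eval_κ_gT i hi r, ← equiv_w0 hφ, ← hΦ']
    simp only [hw, map_sum, map_smul, smul_eval]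

theorem bound2 {a b c d e f : ℕ} {φ : VV a b c d →ₗ[ℂ] R12}
    (hφ : IsEquivariantMap (VV a b c d) (V2 e f) φ)
    {m : Fin 12 →₀ ℕ} (hm : coeff m (evw a b c d φ) ≠ 0) : m (xv 2) ≤ b :=
  bound_aux hφ 2 _ b _ (w0_expand2 a b c d) hm

theorem bound0 {a b c d e f : ℕ} {φ : VV a b c d →ₗ[ℂ] R12}
    (hφ : IsEquivariantMap (VV a b c d) (V2 e f) φ)
    {m : Fin 12 →₀ ℕ} (hm : coeff m (evw a b c d φ) ≠ 0) : m (xv 0) ≤ d :=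
  bound_aux hφ 0 _ d _ (w0_expand0 a b c d) hm

theorem supp_J {a b c d e f : ℕ} {s t : ℤ}
    (hs : 3 * s = ((a : ℤ) + c - e) + 2 * ((b : ℤ) + d - f))
    (ht : 3 * t = ((a : ℤ) + c - e) - ((b : ℤ) + d - f)) (h0 : 0 ≤ t)
    {φ : VV a b c d →ₗ[ℂ] R12}
    (hφ : IsEquivariantMap (VV a b c d) (V2 e f) φ)
    {m : Fin 12 →₀ ℕ} (hm : coeff m (evw a b c d φ) ≠ 0) :
    ∃ j, Jcond a b c d s t j ∧ m = exJ a b c d e s t j := by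
  obtain ⟨a1, a2, a3, a4, a5, a6, a7⟩ := supp_v hφ hm
  have b2 := bound2 hφ hm
  have b0 := bound0 hφ hm
  refine ⟨b - m (xv 2), ?_, ?_⟩
  · refine ⟨?_, ?_, ?_, ?_, ?_, ?_, ?_, ?_, ?_, ?_⟩ <;> omega
  · ext k
    revert k
    apply forall12 <;> intro k
    · fin_cases k <;> simp [exJ, ex3] <;> omega
    · fin_cases k <;> simp [exJ, ex3] <;> omega
    · simp [exJ, ex3, a6]
    · simp [exJ, ex3, a7]

theorem equiv_span {a b c d e f : ℕ} {S : Set (VV a b c d →ₗ[ℂ] R12)}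
    (hS : ∀ φ ∈ S, IsEquivariantMap (VV a b c d) (V2 e f) φ) {φ : VV a b c d →ₗ[ℂ] R12}
    (h : φ ∈ Submodule.span ℂ S) : IsEquivariantMap (VV a b c d) (V2 e f) φ := by
  induction h using Submodule.span_induction with
  | mem x hx => exact hS x hx
  | zero => exact ⟨fun _ => Submodule.zero_mem _, fun g w hw => by simp⟩
  | add x y _ _ hx hy =>
    exact ⟨fun w => Submodule.add_mem _ (hx.1 w) (hy.1 w), fun g w hw => by
      rw [LinearMap.add_apply, LinearMap.add_apply, hx.2, hy.2, map_add]⟩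
  | smul r x _ hx =>
    exact ⟨fun w => Submodule.smul_mem _ _ (hx.1 w), fun g w hw => by
      rw [LinearMap.smul_apply, LinearMap.smul_apply, hx.2, map_smul]⟩

theorem famθ_span {a b c d e f : ℕ} {s t : ℤ}
    (hs : 3 * s = ((a : ℤ) + c - e) + 2 * ((b : ℤ) + d - f))
    (ht : 3 * t = ((a : ℤ) + c - e) - ((b : ℤ) + d - f)) (h0 : 0 ≤ t)
    {π : Module.End ℂ R12} (hπ : IsProj e f π) (φ : VV a b c d →ₗ[ℂ] R12)
    (hφ : IsEquivariantMap (VV a b c d) (V2 e f) φ) :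
    φ ∈ Submodule.span ℂ (Set.range (fun j : {j : ℤ // Jcond a b c d s t j} =>
          (famθ π s t j.val).domRestrict (VV a b c d))) := by
  set S := Submodule.span ℂ (Set.range (fun j : {j : ℤ // Jcond a b c d s t j} =>
          (famθ π s t j.val).domRestrict (VV a b c d))) with hS
  have hmem : evw a b c d φ ∈ S.map (evw a b c d) := by
    rw [(evw a b c d φ).as_sum]
    refine Submodule.sum_mem _ fun m hm => ?_
    obtain ⟨j, hj, rfl⟩ := supp_J hs ht h0 hφ (mem_support_iff.1 hm)
    obtain ⟨k, hk, hk'⟩ := evw_fam hs ht h0 hπ hj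
    rw [← mul_one (coeff _ _), ← smul_eq_mul, ← smul_monomial]
    apply Submodule.smul_mem
    rw [← inv_smul_smul₀ hk (monomial (exJ a b c d e s t j) (1 : ℂ) : R12), ← hk']
    apply Submodule.smul_mem
    exact Submodule.mem_map_of_mem (Submodule.subset_span ⟨⟨j, hj⟩, rfl⟩)
  obtain ⟨φ', hφ', he⟩ := hmem
  have hq : IsEquivariantMap (VV a b c d) (V2 e f) φ' := by
    refine equiv_span ?_ hφ'
    rintro _ ⟨j, rfl⟩
    exact famθ_equiv hs ht h0 hπ j.2
  have h1 : φ' ⟨mn a b c d, mn_mem a b c d⟩ = φ ⟨mn a b c d, mn_mem a b c d⟩ := by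
    rw [← sub_eq_zero]
    apply V2_κ (Submodule.sub_mem _ (hq.1 _) (hφ.1 _))
    rw [evw_apply, evw_apply] at he
    rw [map_sub, he, sub_self]
  have h2 : φ' - φ = 0 := by
    apply generation
    intro g
    rw [LinearMap.sub_apply, equiv_w0 hq, equiv_w0 hφ, h1, sub_self]
  rw [sub_eq_zero] at h2
  rwa [← h2]

/-! ### The symmetry exchanging `e` and `x` -/

/-- the index involution -/
def sw : Fin 12 → Fin 12 := blk xv ev xp ep

theorem sw_sw (k : Fin 12) : sw (sw k) = k := by
  revert k
  apply forall12 <;> intro k <;> simp [sw]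

theorem sw_inj : Function.Injective sw := Function.Involutive.injective sw_sw

/-- the involution of the ring -/
def τ : R12 →ₐ[ℂ] R12 := rename sw

theorem τ_X (k : Fin 12) : τ (X k) = X (sw k) := rename_X _ _

theorem τ_τ (p : R12) : τ (τ p) = p := by
  rw [τ, rename_rename, show sw ∘ sw = id from funext sw_sw, rename_id_apply]

theorem τ_pderiv (k : Fin 12) (p : R12) : pderiv (sw k) (τ p) = τ (pderiv k p) :=
  pderiv_rename sw_inj _ _

theorem τ_ev (i : Fin 3) (p : R12) : pderiv (ev i) (τ p) = τ (pderiv (xv i) p) := by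
  rw [← τ_pderiv]; simp [sw]
theorem τ_xv (i : Fin 3) (p : R12) : pderiv (xv i) (τ p) = τ (pderiv (ev i) p) := by
  rw [← τ_pderiv]; simp [sw]
theorem τ_ep (i : Fin 3) (p : R12) : pderiv (ep i) (τ p) = τ (pderiv (xp i) p) := by
  rw [← τ_pderiv]; simp [sw]
theorem τ_xp (i : Fin 3) (p : R12) : pderiv (xp i) (τ p) = τ (pderiv (ep i) p) := by
  rw [← τ_pderiv]; simp [sw]

theorem pd_comm (i j : Fin 12) (p : R12) : pderiv i (pderiv j p) = pderiv j (pderiv i p) := by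
  have h : ⁅(pderiv i : Derivation ℂ R12 R12), (pderiv j : Derivation ℂ R12 R12)⁆ = 0 := by
    apply derivation_ext
    intro k
    rw [Derivation.commutator_apply, pderiv_X, pderiv_X]
    simp [Pi.single_apply, apply_ite]
  have := DFunLike.congr_fun h p
  rwa [Derivation.commutator_apply, Derivation.zero_apply, sub_eq_zero] at this

theorem α_τ (p : R12) : α (τ p) = τ (β p) := by
  simp only [α_apply, β_apply, τ_ev, τ_xp, map_sum]

theorem β_τ (p : R12) : β (τ p) = τ (α p) := by
  simp only [α_apply, β_apply, τ_xv, τ_ep, map_sum]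

theorem Δ_τ (p : R12) : Δ₂ (τ p) = τ (Δ₂ p) := by
  simp only [Δ_apply, τ_xv, τ_ev, map_sum]
  exact Finset.sum_congr rfl fun i _ => by rw [pd_comm]

theorem Δ'_τ (p : R12) : Δ₂' (τ p) = τ (Δ₂' p) := by
  simp only [Δ'_apply, τ_xp, τ_ep, map_sum]
  exact Finset.sum_congr rfl fun i _ => by rw [pd_comm]

theorem θ_τ (p : R12) : θ (τ p) = τ (ω p) := by
  have h : ∀ i j k, pderiv (ev i) (pderiv (ep j) (X (xv k) * τ p)) =
      τ (X (ev k) * pderiv (xv i) (pderiv (xp j) p)) := by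
    intro i j k
    have : (X (xv k) : R12) * τ p = τ (X (ev k) * p) := by
      rw [map_mul, τ_X]; simp [sw]
    rw [this, τ_ep, τ_ev]
    congr 1
    rw [Derivation.leibniz, pderiv_X_of_ne (by simp), smul_zero, add_zero, smul_eq_mul,
      Derivation.leibniz, pderiv_X_of_ne (by simp), smul_zero, add_zero, smul_eq_mul]
  rw [θ_apply, ω_apply]
  simp only [h, alt, map_sub, map_add]
  abel

theorem μe_τ (p : R12) : μe (τ p) = τ (μx p) := by
  have : μe.comp τ = τ.comp μx := by
    apply algHom_ext
    apply forall12 <;> intro k <;> simp [τ_X, sw]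
  exact DFunLike.congr_fun this p

theorem μx_τ (p : R12) : μx (τ p) = τ (μe p) := by
  have : μx.comp τ = τ.comp μe := by
    apply algHom_ext
    apply forall12 <;> intro k <;> simp [τ_X, sw]
  exact DFunLike.congr_fun this p

theorem qd_τ : τ qd = qd := by
  simp only [qd, map_sum, map_mul, τ_X]
  exact Finset.sum_congr rfl fun i _ => by simp [sw, mul_comm]

theorem inv_transpose_entry (g : SL(3, ℂ)) (i j : Fin 3) :
    (g.transpose⁻¹).val i j = (g⁻¹).val j i := by
  rw [Matrix.SpecialLinearGroup.coe_inv, Matrix.SpecialLinearGroup.coe_inv,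
    Matrix.SpecialLinearGroup.coe_transpose, ← Matrix.adjugate_transpose, Matrix.transpose_apply]

theorem ρ_τ (g : SL(3, ℂ)) (p : R12) : ρ₂ g (τ p) = τ (ρ₂ (g.transpose⁻¹) p) := by
  have : (ρ₂ g).comp τ = τ.comp (ρ₂ (g.transpose⁻¹)) := by
    apply algHom_ext
    apply forall12 <;> intro k <;>
      simp only [AlgHom.comp_apply, ρ₂_ev, ρ₂_xv, ρ₂_ep, ρ₂_xp, τ_X, map_sum, map_smul, sw, blk_ev,
        blk_xv, blk_ep, blk_xp, inv_transpose_entry, inv_inv,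
        Matrix.SpecialLinearGroup.coe_transpose, Matrix.transpose_apply]
  exact DFunLike.congr_fun this p

theorem τ_eq : τ = aeval (fun k => (X (sw k) : R12)) := by
  apply algHom_ext
  intro k
  rw [τ_X, aeval_X]

theorem SD4_τ {a b c d : ℕ} {p : R12} (h : p ∈ SD4 a b c d) : τ p ∈ SD4 b a d c := by
  rw [mem_SD4] at h ⊢
  obtain ⟨h1, h2, h3, h4⟩ := h
  rw [τ_eq]
  refine ⟨wh_aeval (forall12 ?_ ?_ ?_ ?_) h2, wh_aeval (forall12 ?_ ?_ ?_ ?_) h1,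
    wh_aeval (forall12 ?_ ?_ ?_ ?_) h4, wh_aeval (forall12 ?_ ?_ ?_ ?_) h3⟩
  all_goals
    intro i
    exact wh_X _ _ (by simp [wE_eq, wX_eq, wEp_eq, wXp_eq, sw])

theorem VV_τ {a b c d : ℕ} {p : R12} (h : p ∈ VV a b c d) : τ p ∈ VV b a d c := by
  obtain ⟨⟨h1, h2⟩, h3⟩ := h
  refine ⟨⟨SD4_τ h1, ?_⟩, ?_⟩
  · rw [SetLike.mem_coe, LinearMap.mem_ker] at h2 ⊢
    rw [Δ_τ, h2, map_zero]
  · rw [SetLike.mem_coe, LinearMap.mem_ker] at h3 ⊢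
    rw [Δ'_τ, h3, map_zero]

theorem V2_τ {e f : ℕ} {p : R12} (h : p ∈ V2 e f) : τ p ∈ V2 f e := by
  obtain ⟨h1, h2⟩ := h
  refine ⟨?_, SD4_τ h2⟩
  rw [SetLike.mem_coe, LinearMap.mem_ker] at h1 ⊢
  rw [Δ_τ, h1, map_zero]

theorem SDsub2_τ {e f : ℕ} {p : R12} (h : p ∈ SDsub2 e f) : τ p ∈ SDsub2 f e := by
  rw [SDsub2] at h ⊢
  by_cases h0 : e = 0 ∨ f = 0
  · rw [if_pos h0] at h
    rw [(Submodule.mem_bot ℂ).1 h, map_zero]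
    exact Submodule.zero_mem _
  · rw [if_neg h0] at h
    rw [if_neg (by tauto)]
    exact SD4_τ h

/-- the transported projection -/
def πτ (π : Module.End ℂ R12) : Module.End ℂ R12 := τ.toLinearMap ∘ₗ π ∘ₗ τ.toLinearMap

theorem πτ_apply (π : Module.End ℂ R12) (p : R12) : πτ π p = τ (π (τ p)) := rfl

theorem IsProj.τ {e f : ℕ} {π : Module.End ℂ R12} (hπ : IsProj e f π) : IsProj f e (πτ π) := by
  intro p hp
  obtain ⟨h1, q, hq, hq'⟩ := hπ _ (SD4_τ hp : _ ∈ SD2 e f)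
  refine ⟨V2_τ h1, _root_.τ q, SDsub2_τ hq, ?_⟩
  rw [δ_apply] at hq' ⊢
  rw [πτ_apply]
  have h2 := congrArg _root_.τ hq'
  rwa [map_mul, qd_τ, map_sub, τ_τ] at h2

theorem pow_τ {T U : Module.End ℂ R12} (h : ∀ p, T (τ p) = τ (U p)) (n : ℕ)
    (p : R12) : (T ^ n) (τ p) = τ ((U ^ n) p) := by
  induction n generalizing p with
  | zero => simp
  | succ n ih => rw [pow_succ, pow_succ, Module.End.mul_apply, Module.End.mul_apply, h, ih]

theorem αβ_comm : Commute α β := by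
  apply LinearMap.ext
  intro p
  rw [Module.End.mul_apply, Module.End.mul_apply, α_apply, β_apply, α_apply, β_apply]
  simp only [map_sum]
  rw [Finset.sum_comm]
  refine Finset.sum_congr rfl fun i _ => Finset.sum_congr rfl fun j _ => ?_
  rw [pd_comm (xp j), pd_comm (ev j), pd_comm (xp j) (ep i), pd_comm (ev j) (ep i)]

theorem famω_eq (π : Module.End ℂ R12) (s t j : ℤ) (p : R12) :
    τ (famω π s t j (τ p)) = famθ (πτ π) (s + t) (-t) (s + t - j) p := by
  have e1 : ∀ q, famω π s t j q = π (μx ((ω ^ (-t).toNat) (μe ((β ^ j.toNat)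
    ((α ^ (s + t - j).toNat) q))))) := fun _ => rfl
  obtain ⟨q, rfl⟩ : ∃ q, p = τ q := ⟨τ p, (τ_τ p).symm⟩
  rw [famθ_apply, inner_apply, e1, τ_τ, show s + t - (s + t - j) = j by ring, pow_τ α_τ,
    pow_τ β_τ, μx_τ, pow_τ θ_τ, μe_τ, πτ_apply, τ_τ, ← Module.End.mul_apply,
    ← Module.End.mul_apply (α ^ _), ((αβ_comm.pow_pow _ _).eq : α ^ _ * β ^ _ = _)]

/-- restriction of `τ` -/
def τV (a b c d : ℕ) : VV a b c d →ₗ[ℂ] VV b a d c :=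
  LinearMap.restrict τ.toLinearMap (fun _ h => VV_τ h)

theorem τV_val (a b c d : ℕ) (w : VV a b c d) : (τV a b c d w).val = τ w.val := rfl

/-- transport of maps -/
def TT (a b c d : ℕ) : (VV a b c d →ₗ[ℂ] R12) →ₗ[ℂ] (VV b a d c →ₗ[ℂ] R12) where
  toFun φ := τ.toLinearMap ∘ₗ φ ∘ₗ τV b a d c
  map_add' x y := by ext w; simp
  map_smul' r x := by ext w; simp

theorem TT_apply {a b c d : ℕ} (φ : VV a b c d →ₗ[ℂ] R12) (w : VV b a d c) :
    TT a b c d φ w = τ (φ (τV b a d c w)) := rfl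

theorem TT_TT {a b c d : ℕ} (φ : VV a b c d →ₗ[ℂ] R12) : TT b a d c (TT a b c d φ) = φ := by
  apply LinearMap.ext
  intro w
  rw [TT_apply, TT_apply, τ_τ]
  congr 1
  apply Subtype.ext
  rw [τV_val, τV_val, τ_τ]

theorem TT_equiv {a b c d e f : ℕ} {φ : VV a b c d →ₗ[ℂ] R12}
    (hφ : IsEquivariantMap (VV a b c d) (V2 e f) φ) :
    IsEquivariantMap (VV b a d c) (V2 f e) (TT a b c d φ) := by
  constructor
  · intro w
    exact V2_τ (hφ.1 _)
  · intro g w hw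
    rw [TT_apply, TT_apply, ρ_τ, ← hφ.2 _ _ (VV_ρ' _ (τV b a d c w).2)]
    congr 2
    apply Subtype.ext
    change τ (ρ₂ g w.val) = ρ₂ (g.transpose⁻¹) (τ w.val)
    rw [← τ_τ (ρ₂ (g.transpose⁻¹) _), ← ρ_τ, τ_τ]

theorem TT_famω {a b c d : ℕ} (π : Module.End ℂ R12) (s t j : ℤ) :
    TT a b c d ((famω π s t j).domRestrict (VV a b c d)) =
      (famθ (πτ π) (s + t) (-t) (s + t - j)).domRestrict (VV b a d c) := by
  apply LinearMap.ext
  intro w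
  rw [TT_apply, LinearMap.domRestrict_apply, LinearMap.domRestrict_apply, τV_val, famω_eq]

theorem TT_famθ {a b c d : ℕ} (π : Module.End ℂ R12) (s t j : ℤ) :
    TT b a d c ((famθ (πτ π) (s + t) (-t) (s + t - j)).domRestrict (VV b a d c)) =
      (famω π s t j).domRestrict (VV a b c d) := by
  rw [← TT_famω, TT_TT]

theorem J_swap {a b c d : ℕ} {s t j : ℤ} (h0 : t ≤ 0) (h : Jcond a b c d s t j) :
    Jcond b a d c (s + t) (-t) (s + t - j) := by
  obtain ⟨h1, h2, h3, h4, h5, h6, h7, h8, h9, h10⟩ := h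
  refine ⟨?_, ?_, ?_, ?_, ?_, ?_, ?_, ?_, ?_, ?_⟩ <;> omega

theorem J_swap' {a b c d : ℕ} {s t j : ℤ} (h0 : t ≤ 0) (h : Jcond b a d c (s + t) (-t) j) :
    Jcond a b c d s t (s + t - j) := by
  obtain ⟨h1, h2, h3, h4, h5, h6, h7, h8, h9, h10⟩ := h
  refine ⟨?_, ?_, ?_, ?_, ?_, ?_, ?_, ?_, ?_, ?_⟩ <;> omega

section
variable {a b c d e f : ℕ} {s t : ℤ} {π : Module.End ℂ R12}

theorem famω_equiv
    (hs : 3 * s = ((a : ℤ) + c - e) + 2 * ((b : ℤ) + d - f))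
    (ht : 3 * t = ((a : ℤ) + c - e) - ((b : ℤ) + d - f)) (h0 : t ≤ 0)
    (hπ : IsProj e f π) {j : ℤ} (hj : Jcond a b c d s t j) :
    IsEquivariantMap (VV a b c d) (V2 e f) ((famω π s t j).domRestrict (VV a b c d)) := by
  rw [← TT_famθ]
  exact TT_equiv (famθ_equiv (by linarith) (by linarith) (by linarith) hπ.τ (J_swap h0 hj))

theorem famω_indep
    (hs : 3 * s = ((a : ℤ) + c - e) + 2 * ((b : ℤ) + d - f))
    (ht : 3 * t = ((a : ℤ) + c - e) - ((b : ℤ) + d - f)) (h0 : t ≤ 0)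
    (hπ : IsProj e f π) : LinearIndependent ℂ (fun j : {j : ℤ // Jcond a b c d s t j} =>
        (famω π s t j.val).domRestrict (VV a b c d)) := by
  apply LinearIndependent.of_comp (TT a b c d)
  have h := famθ_indep (a := b) (b := a) (c := d) (d := c) (e := f) (f := e) (s := s + t) (t := -t)
    (by linarith) (by linarith) (by linarith) hπ.τ
  have h' := h.comp (fun j : {j : ℤ // Jcond a b c d s t j} =>
    (⟨s + t - j.val, J_swap h0 j.2⟩ : {j : ℤ // Jcond b a d c (s + t) (-t) j})) (by
      intro j j' hjj
      have := congrArg Subtype.val hjj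
      apply Subtype.ext
      simpa using this)
  convert h' using 1
  funext j
  exact TT_famω π s t j.val

theorem famω_span
    (hs : 3 * s = ((a : ℤ) + c - e) + 2 * ((b : ℤ) + d - f))
    (ht : 3 * t = ((a : ℤ) + c - e) - ((b : ℤ) + d - f)) (h0 : t ≤ 0)
    (hπ : IsProj e f π) (φ : VV a b c d →ₗ[ℂ] R12)
    (hφ : IsEquivariantMap (VV a b c d) (V2 e f) φ) :
    φ ∈ Submodule.span ℂ (Set.range (fun j : {j : ℤ // Jcond a b c d s t j} =>
          (famω π s t j.val).domRestrict (VV a b c d))) := by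
  have h := famθ_span (s := s + t) (t := -t) (by linarith) (by linarith) (by linarith) hπ.τ _
    (TT_equiv hφ)
  have h2 := Submodule.mem_map_of_mem (f := TT b a d c) h
  rw [TT_TT, Submodule.map_span] at h2
  refine Submodule.span_mono ?_ h2
  rintro _ ⟨_, ⟨j, rfl⟩, rfl⟩
  refine ⟨⟨_, J_swap' h0 j.2⟩, ?_⟩
  dsimp only
  rw [← TT_famθ, sub_sub_cancel]

end

/-- Theorem 3.1 of the paper: given the projection `π = π_{e,f}` of `S^eD^f` onto `V(e,f)`
along `δ(S^{e-1}D^{f-1})`, the restrictions to `V(a,b)⊗V(c,d)` of the maps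
`π_{e,f} ∘ μ_e ∘ θ^t ∘ μ_x ∘ β^j ∘ α^{s-j}` (for `t ≥ 0`), resp. of
`π_{e,f} ∘ μ_x ∘ ω^{-t} ∘ μ_e ∘ β^j ∘ α^{s+t-j}` (for `t ≤ 0`), indexed by `j ∈ J`, form a
basis of the `ℂ`-vector space of `SL₃(ℂ)`-equivariant linear maps
`V(a,b)⊗V(c,d) → V(e,f)`: each of them is such an equivariant map, they are linearly
independent, and every equivariant map is in their span. -/
theorem stmt0 (a b c d e f : ℕ) (s t : ℤ)
    (hs : 3 * s = ((a : ℤ) + c - e) + 2 * ((b : ℤ) + d - f))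
    (ht : 3 * t = ((a : ℤ) + c - e) - ((b : ℤ) + d - f))
    (π : Module.End ℂ R12)
    (hπ : ∀ p ∈ SD2 e f, π p ∈ V2 e f ∧ p - π p ∈ (SDsub2 e f).map δ₂) :
    (0 ≤ t →
      (∀ j : {j : ℤ // Jcond a b c d s t j},
        IsEquivariantMap (VV a b c d) (V2 e f) ((famθ π s t j.val).domRestrict (VV a b c d))) ∧
      LinearIndependent ℂ (fun j : {j : ℤ // Jcond a b c d s t j} =>
        (famθ π s t j.val).domRestrict (VV a b c d)) ∧
      (∀ φ : VV a b c d →ₗ[ℂ] R12, IsEquivariantMap (VV a b c d) (V2 e f) φ →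
        φ ∈ Submodule.span ℂ (Set.range (fun j : {j : ℤ // Jcond a b c d s t j} =>
          (famθ π s t j.val).domRestrict (VV a b c d))))) ∧
    (t ≤ 0 →
      (∀ j : {j : ℤ // Jcond a b c d s t j},
        IsEquivariantMap (VV a b c d) (V2 e f) ((famω π s t j.val).domRestrict (VV a b c d))) ∧
      LinearIndependent ℂ (fun j : {j : ℤ // Jcond a b c d s t j} =>
        (famω π s t j.val).domRestrict (VV a b c d)) ∧
      (∀ φ : VV a b c d →ₗ[ℂ] R12, IsEquivariantMap (VV a b c d) (V2 e f) φ →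
        φ ∈ Submodule.span ℂ (Set.range (fun j : {j : ℤ // Jcond a b c d s t j} =>
          (famω π s t j.val).domRestrict (VV a b c d))))) := by
  exact ⟨fun h0 => ⟨fun j => famθ_equiv hs ht h0 hπ j.2, famθ_indep hs ht h0 hπ,
      famθ_span hs ht h0 hπ⟩, fun h0 => ⟨fun j => famω_equiv hs ht h0 hπ j.2, famω_indep hs ht h0 hπ,
      famω_span hs ht h0 hπ⟩⟩
end
end

section
/- Let a, b, c, d, e, f be nonnegative integers such that s := ((a+c-e)+2(b+d-f))/3 and t := ((a+c-e)-(b+d-f))/3 are integers with t ≤ 0, and let j be an integer satisfying 0 ≤ j, j ≤ s+t, s+t ≤ c+d, 0 ≤ s-j, s-j ≤ d, s+t-j ≤ a, j ≤ b, j ≤ b+t, j ≤ c-t, j ≤ c. Let m := e₁^a · x₃^b · (e₃')^c · (x₁')^d ∈ R₂. Then (μ_x ∘ ω^{-t} ∘ μ_e ∘ β^j ∘ α^{s+t-j})(m) = λ · e₁^{a-s-t+j} e₂^{-t} e₃^{c-j} x₁^{d-s+j} x₃^{b+t-j} for some nonzero constant λ ∈ ℂ; in particular the result is a nonzero monomial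 lying in S^eD^f. -/
open MvPolynomial

noncomputable section

/-- the monomial `m = e₁^a · x₃^b · (e₃')^c · (x₁')^d ∈ R₂` -/
def mon (a b c d : ℕ) : R12 :=
  X (ev 0) ^ a * X (xv 2) ^ b * X (ep 2) ^ c * X (xp 0) ^ d

/-- auxiliary monomial -/
def auxP (A k C B p D : ℕ) : R12 :=
  X (ev 0) ^ A * X (ev 1) ^ k * X (ev 2) ^ C * X (xv 2) ^ B * X (ep 2) ^ p * X (xp 0) ^ D

theorem aux_α (A k C B p D : ℕ) : α (auxP (A + 1) k C B p (D + 1)) =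
    (((A : ℂ) + 1) * ((D : ℂ) + 1)) • auxP A k C B p D := by
  simp [α, auxP, Fin.sum_univ_three, Derivation.leibniz, pderiv_X, ev, xv, ep, xp,
    MvPolynomial.smul_eq_C_mul]
  try ring

theorem aux_β (A k C B p D : ℕ) : β (auxP A k C (B + 1) (p + 1) D) =
    (((B : ℂ) + 1) * ((p : ℂ) + 1)) • auxP A k C B p D := by
  simp [β, auxP, Fin.sum_univ_three, Derivation.leibniz, pderiv_X, ev, xv, ep, xp,
    MvPolynomial.smul_eq_C_mul]
  try ring

/-- the cyclic permutation contributing to ω -/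
theorem aux_ω (A k C B D : ℕ) : ω (auxP A k C (B + 1) 0 (D + 1)) =
    (((B : ℂ) + 1) * ((D : ℂ) + 1)) • auxP A (k + 1) C B 0 D := by
  have key : ∀ σ : Equiv.Perm (Fin 3), σ ≠ finRotate 3 → ¬ (σ 1 = 2 ∧ σ 2 = 0) := by decide
  have hx : ∀ i : Fin 3, i ≠ 2 → (pderiv (xv i)) (auxP A k C (B + 1) 0 D) = 0 := by
    intro i hi
    fin_cases i <;>
    simp [auxP, Derivation.leibniz, pderiv_X, ev, xv, ep, xp] at hi ⊢
  have hp : ∀ i : Fin 3, (pderiv (xp i)) (auxP A k C (B + 1) 0 (D + 1)) =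
      if i = 0 then ((D : ℂ) + 1) • auxP A k C (B + 1) 0 D else 0 := by
    intro i
    fin_cases i <;>
    simp [auxP, Derivation.leibniz, pderiv_X, ev, xv, ep, xp,
      MvPolynomial.smul_eq_C_mul]
    try ring
  have h2 : (pderiv (xv 2)) (auxP A k C (B + 1) 0 D) = ((B : ℂ) + 1) • auxP A k C B 0 D := by
    simp [auxP, Derivation.leibniz, pderiv_X, ev, xv, ep, xp,
      MvPolynomial.smul_eq_C_mul]
    try ring
  have hsgn : Equiv.Perm.sign (finRotate 3) = 1 := by decide
  have h0 : finRotate 3 0 = 1 := by decide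
  have h1 : finRotate 3 1 = 2 := by decide
  have h3 : finRotate 3 2 = 0 := by decide
  rw [ω, LinearMap.sum_apply, Finset.sum_eq_single (finRotate 3)]
  · simp only [LinearMap.smul_apply, LinearMap.comp_apply, LinearMap.mulLeft_apply, hsgn, h0, h1, h3,
      Derivation.coeFn_coe, hp, if_true, map_smul, h2]
    simp only [auxP, MvPolynomial.smul_eq_C_mul]
    simp
    ring
  · intro σ _ hσ
    have := key σ hσ
    simp only [LinearMap.smul_apply, LinearMap.comp_apply, LinearMap.mulLeft_apply,
      Derivation.coeFn_coe, hp]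
    by_cases h : σ 2 = 0
    · have h' : σ 1 ≠ 2 := fun h' => this ⟨h', h⟩
      simp [h, hx _ h']
    · simp [h]
  · simp

theorem aux_α_pow (n A k C B p D : ℕ) : ∃ l : ℂ, l ≠ 0 ∧
    (α ^ n) (auxP (A + n) k C B p (D + n)) = l • auxP A k C B p D := by
  induction n with
  | zero => exact ⟨1, one_ne_zero, by simp⟩
  | succ n ih =>
    obtain ⟨l, hl, h⟩ := ih
    refine ⟨(((A + n : ℕ) : ℂ) + 1) * (((D + n : ℕ) : ℂ) + 1) * l,
      mul_ne_zero (mul_ne_zero (Nat.cast_add_one_ne_zero _) (Nat.cast_add_one_ne_zero _)) hl, ?_⟩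
    rw [pow_succ, Module.End.mul_apply, ← add_assoc, ← add_assoc, aux_α, map_smul, h, smul_smul]

theorem aux_β_pow (n A k C B p D : ℕ) : ∃ l : ℂ, l ≠ 0 ∧
    (β ^ n) (auxP A k C (B + n) (p + n) D) = l • auxP A k C B p D := by
  induction n with
  | zero => exact ⟨1, one_ne_zero, by simp⟩
  | succ n ih =>
    obtain ⟨l, hl, h⟩ := ih
    refine ⟨(((B + n : ℕ) : ℂ) + 1) * (((p + n : ℕ) : ℂ) + 1) * l,
      mul_ne_zero (mul_ne_zero (Nat.cast_add_one_ne_zero _) (Nat.cast_add_one_ne_zero _)) hl, ?_⟩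
    rw [pow_succ, Module.End.mul_apply, ← add_assoc, ← add_assoc, aux_β, map_smul, h, smul_smul]

theorem aux_ω_pow (n A k C B D : ℕ) : ∃ l : ℂ, l ≠ 0 ∧
    (ω ^ n) (auxP A k C (B + n) 0 (D + n)) = l • auxP A (k + n) C B 0 D := by
  induction n generalizing k with
  | zero => exact ⟨1, one_ne_zero, by simp⟩
  | succ n ih =>
    obtain ⟨l, hl, h⟩ := ih (k + 1)
    refine ⟨(((B + n : ℕ) : ℂ) + 1) * (((D + n : ℕ) : ℂ) + 1) * l,
      mul_ne_zero (mul_ne_zero (Nat.cast_add_one_ne_zero _) (Nat.cast_add_one_ne_zero _)) hl, ?_⟩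
    rw [pow_succ, Module.End.mul_apply, ← add_assoc, ← add_assoc, aux_ω, map_smul, h, smul_smul,
      show k + 1 + n = k + n + 1 by ring]
    rfl

theorem aux_μe (A B p D : ℕ) : μe (auxP A 0 0 B p D) = auxP A 0 p B 0 D := by
  simp [μe, auxP, ev, xv, ep, xp]
  try ring

theorem aux_μx (A k C B D : ℕ) : μx (auxP A k C B 0 D) =
    X (ev 0) ^ A * X (ev 1) ^ k * X (ev 2) ^ C * X (xv 0) ^ D * X (xv 2) ^ B := by
  simp [μx, auxP, ev, xv, ep, xp]
  try ring

theorem aux_hom (w : Fin 12 → ℕ) (A k C D B n : ℕ)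
    (h : A * w (ev 0) + k * w (ev 1) + C * w (ev 2) + D * w (xv 0) + B * w (xv 2) = n) :
    (X (ev 0) ^ A * X (ev 1) ^ k * X (ev 2) ^ C * X (xv 0) ^ D * X (xv 2) ^ B : R12) ∈
      weightedHomogeneousSubmodule ℂ w n := by
  rw [mem_weightedHomogeneousSubmodule, ← h]
  have hX : ∀ i m, IsWeightedHomogeneous w (X i ^ m : R12) (m * w i) := fun i m => by
    simpa using (isWeightedHomogeneous_X ℂ w i).pow m
  exact ((((hX _ _).mul (hX _ _)).mul (hX _ _)).mul (hX _ _)).mul (hX _ _)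

/-- Key monomial computation (case `t ≤ 0`): for `j` satisfying the inequalities of
Theorem 3.1, `(μ_x ∘ ω^{-t} ∘ μ_e ∘ β^j ∘ α^{s+t-j})(m)` is a nonzero multiple of the monomial
`e₁^{a-s-t+j} e₂^{-t} e₃^{c-j} x₁^{d-s+j} x₃^{b+t-j}`, which lies in `S^eD^f`. -/
theorem stmt3 (a b c d e f : ℕ) (s t j : ℤ)
    (hs : 3 * s = ((a : ℤ) + c - e) + 2 * ((b : ℤ) + d - f))
    (ht : 3 * t = ((a : ℤ) + c - e) - ((b : ℤ) + d - f))
    (htneg : t ≤ 0)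
    (hj : 0 ≤ j ∧ j ≤ s + t ∧ s + t ≤ (c : ℤ) + d ∧
      0 ≤ s - j ∧ s - j ≤ (d : ℤ) ∧ s + t - j ≤ (a : ℤ) ∧ j ≤ (b : ℤ) ∧
      j ≤ (b : ℤ) + t ∧ j ≤ (c : ℤ) - t ∧ j ≤ (c : ℤ)) :
    ∃ lam : ℂ, lam ≠ 0 ∧
      μx ((ω ^ (-t).toNat) (μe ((β ^ j.toNat) ((α ^ (s + t - j).toNat) (mon a b c d))))) =
        lam • (X (ev 0) ^ ((a : ℤ) - s - t + j).toNat * X (ev 1) ^ (-t).toNat *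
          X (ev 2) ^ ((c : ℤ) - j).toNat * X (xv 0) ^ ((d : ℤ) - s + j).toNat *
          X (xv 2) ^ ((b : ℤ) + t - j).toNat) ∧
      (X (ev 0) ^ ((a : ℤ) - s - t + j).toNat * X (ev 1) ^ (-t).toNat *
        X (ev 2) ^ ((c : ℤ) - j).toNat * X (xv 0) ^ ((d : ℤ) - s + j).toNat *
        X (xv 2) ^ ((b : ℤ) + t - j).toNat) ∈ SD2 e f := by
  obtain ⟨h1, h2, h3, h4, h5, h6, h7, h8, h9, h10⟩ := hj
  obtain ⟨n, hn⟩ : ∃ n : ℕ, (n : ℤ) = -t := ⟨(-t).toNat, by omega⟩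
  obtain ⟨q, hq⟩ : ∃ q : ℕ, (q : ℤ) = j := ⟨j.toNat, by omega⟩
  obtain ⟨r, hr⟩ : ∃ r : ℕ, (r : ℤ) = s + t - j := ⟨(s + t - j).toNat, by omega⟩
  obtain ⟨A, hA⟩ : ∃ A : ℕ, (A : ℤ) = a - s - t + j := ⟨(a - s - t + j).toNat, by omega⟩
  obtain ⟨C, hC⟩ : ∃ C : ℕ, (C : ℤ) = c - j := ⟨(c - j).toNat, by omega⟩
  obtain ⟨D, hD⟩ : ∃ D : ℕ, (D : ℤ) = d - s + j := ⟨(d - s + j).toNat, by omega⟩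
  obtain ⟨B, hB⟩ : ∃ B : ℕ, (B : ℤ) = b + t - j := ⟨(b + t - j).toNat, by omega⟩
  rw [← hn, ← hr, ← hA, ← hC, ← hD, ← hB, ← hq]
  simp only [Int.toNat_natCast]
  have ha : a = A + r := by omega
  have hb : b = B + n + q := by omega
  have hc : c = C + q := by omega
  have hd : d = D + n + r := by omega
  have hm : mon a b c d = auxP (A + r) 0 0 (B + n + q) (C + q) (D + n + r) := by
    rw [mon, auxP, ha, hb, hc, hd]; ring
  obtain ⟨l1, hl1, e1⟩ := aux_α_pow r A 0 0 (B + n + q) (C + q) (D + n)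
  obtain ⟨l2, hl2, e2⟩ := aux_β_pow q A 0 0 (B + n) C (D + n)
  obtain ⟨l3, hl3, e3⟩ := aux_ω_pow n A 0 C B D
  refine ⟨l1 * l2 * l3, mul_ne_zero (mul_ne_zero hl1 hl2) hl3, ?_, ?_⟩
  · simp only [hm, e1, e2, e3, map_smul, aux_μe, aux_μx, smul_smul, zero_add, mul_assoc]
  · refine ⟨⟨⟨aux_hom _ _ _ _ _ _ _ ?_, aux_hom _ _ _ _ _ _ _ ?_⟩, aux_hom _ _ _ _ _ _ _ ?_⟩,
      aux_hom _ _ _ _ _ _ _ ?_⟩ <;> simp [wE, wX, wEp, wXp, ev, xv] <;> omega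
end
end

section
/- Let d₁, d₂ be nonnegative integers. The ℂ-linear map V(d₁) ⊗ V(d₂) → ⊕_{n=0}^{min(d₁,d₂)} V(d₁+d₂−2n) induced by f ⊗ g ↦ (ψ_n(f,g))_{n=0,…,min(d₁,d₂)} is a linear isomorphism and is SL₂(ℂ)-equivariant (where SL₂(ℂ) acts diagonally on the tensor product and componentwise on the direct sum); i.e. it is an isomorphism of SL₂(ℂ)-modules (the Clebsch–Gordan decomposition). -/
open MvPolynomial

noncomputable section

open scoped MatrixGroups

/-- the polynomial ring `ℂ[z₁,z₂]` -/
abbrev P2 : Type := MvPolynomial (Fin 2) ℂ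

/-- `V(d) = Sym^d(ℂ²)`: homogeneous polynomials of degree `d` in `z₁, z₂` -/
def Vd (d : ℕ) : Submodule ℂ P2 := homogeneousSubmodule (Fin 2) ℂ d

/-- The action of `SL₂(ℂ)` on polynomials by linear substitution, `(A·f)(z) = f(A⁻¹z)`. -/
def ρ (A : SL(2, ℂ)) : P2 →ₐ[ℂ] P2 :=
  aeval (fun i : Fin 2 => ∑ j : Fin 2, ((A⁻¹).val i j) • X j)

/-- the `n`-th transvectant
`ψ_n(f,g) = ((d₁−n)!/d₁!)((d₂−n)!/d₂!) Σᵢ (−1)ⁱ C(n,i) (∂ⁿf/∂z₁^{n−i}∂z₂^{i})·(∂ⁿg/∂z₁^{i}∂z₂^{n−i})` -/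
def ψ (d₁ d₂ n : ℕ) (f g : P2) : P2 :=
  ((((d₁ - n).factorial : ℂ) / (d₁.factorial : ℂ)) *
    (((d₂ - n).factorial : ℂ) / (d₂.factorial : ℂ))) •
  ∑ i ∈ Finset.range (n + 1), ((-1 : ℂ) ^ i * (n.choose i : ℂ)) •
    ((((pderiv (0 : Fin 2)).toLinearMap ^ (n - i)) (((pderiv (1 : Fin 2)).toLinearMap ^ i) f)) *
     (((pderiv (0 : Fin 2)).toLinearMap ^ i) (((pderiv (1 : Fin 2)).toLinearMap ^ (n - i)) g)))

open TensorProduct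

abbrev QQ : Type := TensorProduct ℂ P2 P2

def dd (i : Fin 2) : P2 →ₗ[ℂ] P2 := (pderiv i).toLinearMap

def Om : QQ →ₗ[ℂ] QQ := TensorProduct.map (dd 0) (dd 1) - TensorProduct.map (dd 1) (dd 0)

def Dl : QQ := (X 0 : P2) ⊗ₜ[ℂ] (X 1 : P2) - (X 1 : P2) ⊗ₜ[ℂ] (X 0 : P2)

def Eu : P2 →ₗ[ℂ] P2 := ∑ i : Fin 2, (LinearMap.mulLeft ℂ (X i : P2)) ∘ₗ (dd i)

def Hh : QQ →ₗ[ℂ] QQ := TensorProduct.map Eu LinearMap.id + TensorProduct.map LinearMap.id Eu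

def mu : QQ →ₗ[ℂ] P2 := LinearMap.mul' ℂ P2

lemma dd_comm (i j : Fin 2) (f : P2) : dd i (dd j f) = dd j (dd i f) := by
  have h : ⁅pderiv (R := ℂ) i, pderiv (R := ℂ) j⁆ = 0 := by
    apply MvPolynomial.derivation_ext
    intro k
    simp [Derivation.commutator_apply, pderiv_X, Pi.single_apply, apply_ite]
  have := congrArg (fun D => D f) h
  simpa [Derivation.commutator_apply, sub_eq_zero, dd] using this

lemma tm (a b : P2) : a ⊗ₜ[ℂ] b = (a ⊗ₜ[ℂ] (1 : P2)) * ((1 : P2) ⊗ₜ[ℂ] b) := by simp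

lemma tl (a b : P2) : (a * b) ⊗ₜ[ℂ] (1 : P2) = (a ⊗ₜ[ℂ] (1 : P2)) * (b ⊗ₜ[ℂ] (1 : P2)) := by simp
lemma tr (a b : P2) : (1 : P2) ⊗ₜ[ℂ] (a * b) = ((1 : P2) ⊗ₜ[ℂ] a) * ((1 : P2) ⊗ₜ[ℂ] b) := by simp

lemma dd_mul (i : Fin 2) (f g : P2) : dd i (f * g) = f * dd i g + g * dd i f := by
  simp [dd]

lemma dd_X (i j : Fin 2) : dd i (X j) = if i = j then 1 else 0 := by
  simp [dd, pderiv_X, Pi.single_apply, eq_comm]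

lemma Om_Dl (t : QQ) : Om (Dl * t) = Dl * Om t + Hh t + (2 : ℂ) • t := by
  induction t using TensorProduct.induction_on with
  | zero => simp
  | add x y hx hy => rw [mul_add, map_add, hx, hy]; simp only [map_add, mul_add, smul_add]; abel
  | tmul f g =>
    simp only [Om, Dl, Hh, Eu, sub_mul, mul_sub, Algebra.TensorProduct.tmul_mul_tmul, map_sub,
      LinearMap.sub_apply, LinearMap.add_apply, TensorProduct.map_tmul, dd_mul, dd_X,
      Fin.sum_univ_two, LinearMap.comp_apply, LinearMap.mulLeft_apply, LinearMap.id_apply,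
      TensorProduct.add_tmul, TensorProduct.tmul_add]
    simp only [Fin.isValue, ↓reduceIte, zero_ne_one, one_ne_zero, mul_one, mul_zero, 
      TensorProduct.tmul_zero, TensorProduct.zero_tmul]
    rw [two_smul]
    abel

lemma Hh_Om (t : QQ) : Hh (Om t) = Om (Hh t) - (2 : ℂ) • Om t := by
  induction t using TensorProduct.induction_on with
  | zero => simp
  | add x y hx hy => simp only [map_add, hx, hy, smul_add]; abel
  | tmul f g =>
    simp only [Om, Hh, Eu, map_sub, map_add,
      LinearMap.sub_apply, LinearMap.add_apply, TensorProduct.map_tmul, dd_mul, dd_X,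
      Fin.sum_univ_two, LinearMap.comp_apply, LinearMap.mulLeft_apply, LinearMap.id_apply,
      TensorProduct.add_tmul, TensorProduct.tmul_add]
    simp only [Fin.isValue, ↓reduceIte, zero_ne_one, one_ne_zero, mul_one, mul_zero, 
      TensorProduct.tmul_zero, TensorProduct.zero_tmul, dd_comm 1 0]
    rw [two_smul]
    abel

lemma Eu_X (i : Fin 2) (f : P2) : Eu (X i * f) = X i * Eu f + X i * f := by
  simp only [Eu, Fin.sum_univ_two, LinearMap.add_apply, LinearMap.comp_apply,
    LinearMap.mulLeft_apply, dd_mul, dd_X]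
  fin_cases i <;> simp <;> ring

lemma Hh_Dl (t : QQ) : Hh (Dl * t) = Dl * Hh t + (2 : ℂ) • (Dl * t) := by
  induction t using TensorProduct.induction_on with
  | zero => simp
  | add x y hx hy => simp only [map_add, mul_add, hx, hy, smul_add]; abel
  | tmul f g =>
    simp only [Dl, Hh, sub_mul, mul_add, Algebra.TensorProduct.tmul_mul_tmul, map_sub,
      LinearMap.add_apply, TensorProduct.map_tmul, Eu_X, LinearMap.id_apply,
      TensorProduct.add_tmul, TensorProduct.tmul_add]
    rw [two_smul]
    abel

lemma Hh_pow (n : ℕ) (s : ℂ) (t : QQ) (h : Hh t = s • t) :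
    Hh (Dl ^ n * t) = (s + 2 * n) • (Dl ^ n * t) := by
  induction n with
  | zero => simp [h]
  | succ n ih =>
    rw [pow_succ', mul_assoc, Hh_Dl, ih, mul_smul_comm, ← add_smul]
    push_cast; congr 1; ring

lemma Om_pow (n : ℕ) (s : ℂ) (t : QQ) (h : Hh t = s • t) :
    Om (Dl ^ (n + 1) * t) = Dl ^ (n + 1) * Om t + ((n + 1) * (s + n + 2)) • (Dl ^ n * t) := by
  induction n with
  | zero => simp [Om_Dl, h, add_smul, add_assoc]
  | succ n ih =>
    rw [pow_succ', mul_assoc, Om_Dl, ih, Hh_pow _ _ _ h, mul_add, mul_smul_comm, ← mul_assoc,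
      ← mul_assoc, ← pow_succ', ← pow_succ', add_assoc, add_assoc, ← add_smul, ← add_smul]
    push_cast; congr 2; ring

lemma mu_mul (a b : QQ) : mu (a * b) = mu a * mu b :=
  map_mul (Algebra.TensorProduct.lmul' ℂ (S := P2)) a b

lemma mu_Dl : mu Dl = 0 := by
  simp [mu, Dl, mul_comm]

lemma vanish (k : ℕ) : ∀ (n : ℕ) (s : ℂ) (t : QQ), Hh t = s • t → k < n →
    mu ((Om ^ k) (Dl ^ n * t)) = 0 := by
  induction k with
  | zero =>
    intro n s t h hn
    obtain ⟨m, rfl⟩ := Nat.exists_eq_add_of_lt hn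
    simp [pow_succ', mul_assoc, mu_mul, mu_Dl]
  | succ k ih =>
    intro n s t h hn
    obtain ⟨m, rfl⟩ : ∃ m, n = m + 1 := ⟨n - 1, by omega⟩
    rw [pow_succ, Module.End.mul_apply, Om_pow _ _ _ h, map_add, map_add, map_smul, map_smul,
      ih m s t h (by omega), ih (m + 1) (s - 2) (Om t) _ (by omega)]
    · simp
    · rw [Hh_Om, h, map_smul]; exact (sub_smul _ _ _).symm

lemma lead (n : ℕ) (s : ℕ) (t : QQ) (h : Hh t = (s : ℂ) • t) :
    ∃ c : ℂ, c ≠ 0 ∧ mu ((Om ^ n) (Dl ^ n * t)) = c • mu t := by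
  induction n with
  | zero => exact ⟨1, one_ne_zero, by simp⟩
  | succ n ih =>
    obtain ⟨c, hc, e⟩ := ih
    refine ⟨((n + 1) * (s + n + 2)) * c, mul_ne_zero ?_ hc, ?_⟩
    · have : ((n + 1) * (s + n + 2) : ℂ) = (((n + 1) * (s + n + 2) : ℕ) : ℂ) := by push_cast; ring
      rw [this, Nat.cast_ne_zero]; positivity
    · rw [pow_succ, Module.End.mul_apply, Om_pow _ _ _ h, map_add, map_add, map_smul, map_smul, e,
        vanish n (n + 1) (s - 2) (Om t) _ (by omega)]
      · simp [mul_smul]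
      · rw [Hh_Om, h, map_smul]; exact (sub_smul _ _ _).symm

lemma psi_eq (d₁ d₂ n : ℕ) (f g : P2) : ψ d₁ d₂ n f g =
    ((((d₁ - n).factorial : ℂ) / (d₁.factorial : ℂ)) *
    (((d₂ - n).factorial : ℂ) / (d₂.factorial : ℂ))) • mu ((Om ^ n) (f ⊗ₜ[ℂ] g)) := by
  have hc : Commute ((-1 : ℂ) • TensorProduct.map (dd 1) (dd 0))
      (TensorProduct.map (dd 0) (dd 1)) := by
    apply Commute.smul_left
    apply TensorProduct.ext'
    intro x y
    simp [dd_comm 1 0]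
  have : Om = (-1 : ℂ) • TensorProduct.map (dd 1) (dd 0) + TensorProduct.map (dd 0) (dd 1) := by
    rw [Om]; module
  rw [ψ, this, hc.add_pow, LinearMap.sum_apply, map_sum]
  congr 1
  apply Finset.sum_congr rfl
  intro i hi
  have hcd : Commute (dd 1) (dd 0) := LinearMap.ext fun x => dd_comm 1 0 x
  have e1 := (hcd.pow_pow i (n - i)).eq
  have h1 : ((dd 0) ^ (n - i)) (((dd 1) ^ i) f) = ((dd 1) ^ i) (((dd 0) ^ (n - i)) f) := by
    rw [← Module.End.mul_apply, ← e1, Module.End.mul_apply]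
  change _ • (((dd 0) ^ (n - i)) (((dd 1) ^ i) f) * ((dd 0) ^ i) (((dd 1) ^ (n - i)) g)) = _
  rw [h1, smul_pow, TensorProduct.map_pow, TensorProduct.map_pow]
  simp only [LinearMap.smul_apply, Module.End.mul_apply, TensorProduct.map_tmul, smul_mul_assoc,
    map_smul, map_nsmul, mu, LinearMap.mul'_apply, Module.End.natCast_apply]
  rw [← Nat.cast_smul_eq_nsmul ℂ, smul_smul, mul_comm]

lemma chain_s13 (A : SL(2, ℂ)) (i : Fin 2) (f : P2) :
    dd i (ρ A f) = ∑ k : Fin 2, ((A⁻¹).val k i) • ρ A (dd k f) := by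
  induction f using MvPolynomial.induction_on with
  | C a => simp [dd]
  | add p q hp hq => simp only [map_add, hp, hq, smul_add, Finset.sum_add_distrib]
  | mul_X p j hp =>
    rw [map_mul, dd_mul, hp]
    have : dd i (ρ A (X j)) = C ((A⁻¹).val j i) := by
      simp only [ρ, aeval_X, map_sum, map_smul, dd_X]
      fin_cases i <;> simp [Fin.sum_univ_two, Algebra.smul_def]
    rw [this]
    simp only [dd_mul, dd_X, Fin.sum_univ_two, map_add, map_mul, Algebra.smul_def, algebraMap_eq]
    fin_cases j <;> simp <;> ring

lemma Om_rho (A : SL(2, ℂ)) (t : QQ) :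
    Om (TensorProduct.map (ρ A).toLinearMap (ρ A).toLinearMap t) =
      TensorProduct.map (ρ A).toLinearMap (ρ A).toLinearMap (Om t) := by
  induction t using TensorProduct.induction_on with
  | zero => simp
  | add x y hx hy => simp only [map_add, hx, hy]
  | tmul f g =>
    have hdet := (A⁻¹).det_coe
    rw [Matrix.det_fin_two] at hdet
    simp only [Om, LinearMap.sub_apply, map_sub, TensorProduct.map_tmul, AlgHom.toLinearMap_apply,
      chain_s13, Fin.sum_univ_two, TensorProduct.add_tmul, TensorProduct.tmul_add,
      TensorProduct.smul_tmul_smul]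
    generalize (ρ A (dd 0 f)) ⊗ₜ[ℂ] (ρ A (dd 0 g)) = a
    generalize (ρ A (dd 0 f)) ⊗ₜ[ℂ] (ρ A (dd 1 g)) = b
    generalize (ρ A (dd 1 f)) ⊗ₜ[ℂ] (ρ A (dd 0 g)) = c
    generalize (ρ A (dd 1 f)) ⊗ₜ[ℂ] (ρ A (dd 1 g)) = d
    have : b - c = ((A⁻¹).val 0 0 * (A⁻¹).val 1 1 - (A⁻¹).val 0 1 * (A⁻¹).val 1 0) • (b - c) := by
      erw [hdet]; simp
    rw [this]
    module

lemma Om_rho_pow (A : SL(2, ℂ)) (n : ℕ) (t : QQ) :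
    (Om ^ n) (TensorProduct.map (ρ A).toLinearMap (ρ A).toLinearMap t) =
      TensorProduct.map (ρ A).toLinearMap (ρ A).toLinearMap ((Om ^ n) t) := by
  induction n generalizing t with
  | zero => simp
  | succ n ih => rw [pow_succ, Module.End.mul_apply, Om_rho, ih, Module.End.mul_apply]

lemma mu_rho (A : SL(2, ℂ)) (t : QQ) :
    mu (TensorProduct.map (ρ A).toLinearMap (ρ A).toLinearMap t) = ρ A (mu t) := by
  induction t using TensorProduct.induction_on with
  | zero => simp
  | add x y hx hy => simp only [map_add, hx, hy]
  | tmul f g => simp [mu]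

lemma psi_rho (A : SL(2, ℂ)) (d₁ d₂ n : ℕ) (f g : P2) :
    ψ d₁ d₂ n (ρ A f) (ρ A g) = ρ A (ψ d₁ d₂ n f g) := by
  rw [psi_eq, psi_eq, map_smul, ← mu_rho, ← Om_rho_pow]
  simp

def degEquiv (d : ℕ) : {u : Fin 2 →₀ ℕ | u.degree = d} ≃ Fin (d + 1) where
  toFun u := ⟨u.1 0, by
    have := u.2
    simp only [Set.mem_setOf_eq, Finsupp.degree_eq_sum, Fin.sum_univ_two] at this
    omega⟩
  invFun k := ⟨Finsupp.single 0 k.1 + Finsupp.single 1 (d - k.1), by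
    have := k.2
    simp [Finsupp.degree_eq_sum, Fin.sum_univ_two]
    omega⟩
  left_inv u := by
    have := u.2
    simp only [Set.mem_setOf_eq, Finsupp.degree_eq_sum, Fin.sum_univ_two] at this
    ext i
    fin_cases i
    · simp
    · simp; omega
  right_inv k := by ext; simp

lemma Vd_eq (d : ℕ) : Vd d = restrictSupport ℂ {u : Fin 2 →₀ ℕ | u.degree = d} :=
  homogeneousSubmodule_eq_finsupp_supported _ _ d

instance Vd_fin (d : ℕ) : Module.Finite ℂ (Vd d) := by
  rw [Vd_eq]
  have : Finite {u : Fin 2 →₀ ℕ | u.degree = d} := Finite.of_equiv _ (degEquiv d).symm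
  exact Module.Finite.of_basis (basisRestrictSupport ℂ _)

lemma Vd_finrank (d : ℕ) : Module.finrank ℂ (Vd d) = d + 1 := by
  rw [Vd_eq, Module.finrank_eq_nat_card_basis (basisRestrictSupport ℂ _),
    Nat.card_congr (degEquiv d), Nat.card_fin]

open scoped Pointwise in
lemma Vd_mul (a b : ℕ) : Vd (a + b) = Vd a * Vd b := by
  rw [Vd_eq, Vd_eq, Vd_eq, ← restrictSupport_add]
  congr 1
  ext u
  simp only [Set.mem_add, Set.mem_setOf_eq]
  constructor
  · intro h
    simp only [Finsupp.degree_eq_sum, Fin.sum_univ_two] at h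
    refine ⟨Finsupp.single 0 (min (u 0) a) + Finsupp.single 1 (a - min (u 0) a), ?_,
      Finsupp.single 0 (u 0 - min (u 0) a) + Finsupp.single 1 (u 1 - (a - min (u 0) a)), ?_, ?_⟩
    · simp [Finsupp.degree_eq_sum, Fin.sum_univ_two]
    · simp [Finsupp.degree_eq_sum, Fin.sum_univ_two]; omega
    · ext i
      fin_cases i
      · simp
      · simp; omega
  · rintro ⟨x, hx, y, hy, rfl⟩
    rw [map_add, hx, hy]

def io (a b : ℕ) : (Vd a ⊗[ℂ] Vd b) →ₗ[ℂ] QQ := TensorProduct.map (Vd a).subtype (Vd b).subtype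

lemma dd_mem (i : Fin 2) (a : ℕ) (f : P2) (h : f ∈ Vd a) : dd i f ∈ Vd (a - 1) :=
  IsHomogeneous.pderiv (i := i) (show f.IsHomogeneous a from h)

lemma X_mem (i : Fin 2) (a : ℕ) (f : P2) (h : f ∈ Vd a) : X i * f ∈ Vd (a + 1) := by
  rw [add_comm]
  exact IsHomogeneous.mul (isHomogeneous_X ℂ i) h

lemma tm_mem {a b : ℕ} {f g : P2} (hf : f ∈ Vd a) (hg : g ∈ Vd b) :
    f ⊗ₜ[ℂ] g ∈ LinearMap.range (io a b) := ⟨⟨f, hf⟩ ⊗ₜ ⟨g, hg⟩, by simp [io]⟩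

lemma W_ind {a b : ℕ} (N : Submodule ℂ QQ)
    (h : ∀ f ∈ Vd a, ∀ g ∈ Vd b, f ⊗ₜ[ℂ] g ∈ N) : LinearMap.range (io a b) ≤ N := by
  rintro _ ⟨t, rfl⟩
  induction t using TensorProduct.induction_on with
  | zero => simp
  | add x y hx hy => rw [map_add]; exact N.add_mem hx hy
  | tmul f g => exact h _ f.2 _ g.2

lemma Om_mem (a b : ℕ) (t : QQ) (h : t ∈ LinearMap.range (io a b)) :
    Om t ∈ LinearMap.range (io (a - 1) (b - 1)) := by
  refine W_ind ((LinearMap.range (io (a - 1) (b - 1))).comap Om) ?_ h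
  intro f hf g hg
  exact Submodule.sub_mem _ (tm_mem (dd_mem 0 _ _ hf) (dd_mem 1 _ _ hg))
    (tm_mem (dd_mem 1 _ _ hf) (dd_mem 0 _ _ hg))

lemma Om_pow_mem (n a b : ℕ) (t : QQ) (h : t ∈ LinearMap.range (io a b)) :
    (Om ^ n) t ∈ LinearMap.range (io (a - n) (b - n)) := by
  induction n with
  | zero => exact h
  | succ n ih =>
    rw [pow_succ', Module.End.mul_apply]
    exact Om_mem _ _ _ ih

lemma Dl_mem (a b : ℕ) (t : QQ) (h : t ∈ LinearMap.range (io a b)) :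
    Dl * t ∈ LinearMap.range (io (a + 1) (b + 1)) := by
  refine W_ind ((LinearMap.range (io (a + 1) (b + 1))).comap (LinearMap.mulLeft ℂ Dl)) ?_ h
  intro f hf g hg
  rw [Submodule.mem_comap, LinearMap.mulLeft_apply, Dl, sub_mul,
    Algebra.TensorProduct.tmul_mul_tmul, Algebra.TensorProduct.tmul_mul_tmul]
  exact Submodule.sub_mem _ (tm_mem (X_mem 0 _ _ hf) (X_mem 1 _ _ hg))
    (tm_mem (X_mem 1 _ _ hf) (X_mem 0 _ _ hg))

lemma Dl_pow_mem (n a b : ℕ) (t : QQ) (h : t ∈ LinearMap.range (io a b)) :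
    Dl ^ n * t ∈ LinearMap.range (io (a + n) (b + n)) := by
  induction n with
  | zero => simpa using h
  | succ n ih =>
    rw [pow_succ', mul_assoc]
    exact Dl_mem _ _ _ ih

lemma Eu_eq (a : ℕ) (f : P2) (h : f ∈ Vd a) : Eu f = (a : ℂ) • f := by
  have := IsHomogeneous.sum_X_mul_pderiv (show f.IsHomogeneous a from h)
  rw [Nat.cast_smul_eq_nsmul, ← this]
  simp [Eu, dd]

lemma Hh_eq (a b : ℕ) (t : QQ) (h : t ∈ LinearMap.range (io a b)) :
    Hh t = ((a + b : ℕ) : ℂ) • t := by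
  refine W_ind (LinearMap.eqLocus Hh (((a + b : ℕ) : ℂ) • LinearMap.id)) ?_ h
  intro f hf g hg
  simp only [LinearMap.mem_eqLocus, Hh, LinearMap.add_apply, TensorProduct.map_tmul,
    LinearMap.id_apply, Eu_eq a f hf, Eu_eq b g hg, LinearMap.smul_apply, Nat.cast_add, add_smul]
  simp [TensorProduct.smul_tmul']

lemma mu_mem (a b : ℕ) (t : QQ) (h : t ∈ LinearMap.range (io a b)) : mu t ∈ Vd (a + b) := by
  refine W_ind ((Vd (a + b)).comap mu) ?_ h
  intro f hf g hg
  rw [Submodule.mem_comap]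
  exact IsHomogeneous.mul hf hg

lemma mu_surj (a b : ℕ) (p : P2) (h : p ∈ Vd (a + b)) : ∃ t ∈ LinearMap.range (io a b), mu t = p := by
  rw [Vd_mul] at h
  have : Vd a * Vd b ≤ (LinearMap.range (io a b)).map mu := by
    rw [Submodule.mul_le]
    intro f hf g hg
    exact ⟨_, tm_mem hf hg, rfl⟩
  exact this h

def cc (d₁ d₂ n : ℕ) : ℂ := ((((d₁ - n).factorial : ℂ) / (d₁.factorial : ℂ)) *
    (((d₂ - n).factorial : ℂ) / (d₂.factorial : ℂ)))

lemma cc_ne (d₁ d₂ n : ℕ) : cc d₁ d₂ n ≠ 0 := by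
  unfold cc
  have := fun k : ℕ => Nat.cast_ne_zero (R := ℂ).mpr (Nat.factorial_ne_zero k)
  exact mul_ne_zero (div_ne_zero (this _) (this _)) (div_ne_zero (this _) (this _))

lemma comp_mem (d₁ d₂ n : ℕ) (hn : n ≤ min d₁ d₂) (t : Vd d₁ ⊗[ℂ] Vd d₂) :
    (cc d₁ d₂ n • (mu ∘ₗ (Om ^ n) ∘ₗ io d₁ d₂)) t ∈ Vd (d₁ + d₂ - 2 * n) := by
  have e : d₁ + d₂ - 2 * n = (d₁ - n) + (d₂ - n) := by omega
  rw [e]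
  exact Submodule.smul_mem _ _ (mu_mem _ _ _ (Om_pow_mem n _ _ _ ⟨t, rfl⟩))

lemma dims (d₁ d₂ : ℕ) : ∀ m ≤ min d₁ d₂ + 1,
    ∑ n ∈ Finset.range m, (d₁ + d₂ - 2 * n + 1) + (d₁ + 1 - m) * (d₂ + 1 - m)
      = (d₁ + 1) * (d₂ + 1) := by
  intro m
  induction m with
  | zero => simp
  | succ m ih =>
    intro hm
    rw [← ih (by omega), Finset.sum_range_succ]
    obtain ⟨a, rfl⟩ : ∃ a, d₁ = a + m := ⟨d₁ - m, by omega⟩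
    obtain ⟨b, rfl⟩ : ∃ b, d₂ = b + m := ⟨d₂ - m, by omega⟩
    have e1 : a + m + (b + m) - 2 * m = a + b := by omega
    have e2 : a + m + 1 - (m + 1) = a := by omega
    have e3 : b + m + 1 - (m + 1) = b := by omega
    have e4 : a + m + 1 - m = a + 1 := by omega
    have e5 : b + m + 1 - m = b + 1 := by omega
    rw [e1, e2, e3, e4, e5]
    ring

lemma finrank_eq (d₁ d₂ : ℕ) : Module.finrank ℂ (Vd d₁ ⊗[ℂ] Vd d₂) =
    Module.finrank ℂ (∀ n : Fin (min d₁ d₂ + 1), Vd (d₁ + d₂ - 2 * n.val)) := by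
  rw [Module.finrank_tensorProduct, Module.finrank_pi_fintype]
  simp only [Vd_finrank]
  rw [Fin.sum_univ_eq_sum_range (fun n => d₁ + d₂ - 2 * n + 1), ← dims d₁ d₂ _ le_rfl]
  rcases le_total d₁ d₂ with h | h <;> simp [h]

lemma surj (d₁ d₂ : ℕ) (Φ : (Vd d₁ ⊗[ℂ] Vd d₂) →ₗ[ℂ]
      (∀ n : Fin (min d₁ d₂ + 1), Vd (d₁ + d₂ - 2 * n.val)))
    (hΦ : ∀ t n, ((Φ t) n : P2) = cc d₁ d₂ n.val • mu ((Om ^ n.val) (io d₁ d₂ t)))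
    (h : ∀ n : Fin (min d₁ d₂ + 1), Vd (d₁ + d₂ - 2 * n.val)) (m : ℕ) :
    m ≤ min d₁ d₂ + 1 → ∃ t, ∀ n : Fin (min d₁ d₂ + 1), n.val < m → Φ t n = h n := by
  induction m with
  | zero => intro _; exact ⟨0, fun n hn => absurd hn (by omega)⟩
  | succ m ih =>
    intro hm
    obtain ⟨t, ht⟩ := ih (by omega)
    let N : Fin (min d₁ d₂ + 1) := ⟨m, by omega⟩
    have hp : ((h N - Φ t N : Vd (d₁ + d₂ - 2 * N.val)) : P2) ∈ Vd ((d₁ - m) + (d₂ - m)) := by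
      have e : (d₁ - m) + (d₂ - m) = d₁ + d₂ - 2 * N.val := by simp only [N]; omega
      rw [e]
      exact Subtype.property _
    obtain ⟨S, hS, hSp⟩ := mu_surj _ _ _ hp
    obtain ⟨c, hc, hl⟩ := lead m _ S (Hh_eq _ _ _ hS)
    have hD := Dl_pow_mem m _ _ _ hS
    rw [Nat.sub_add_cancel (by omega), Nat.sub_add_cancel (by omega)] at hD
    obtain ⟨u, hu⟩ := hD
    refine ⟨t + (cc d₁ d₂ m * c)⁻¹ • u, fun n hn => ?_⟩
    apply Subtype.ext
    rw [map_add, map_smul, Pi.add_apply, Pi.smul_apply, Submodule.coe_add, Submodule.coe_smul,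
      hΦ u n, hu]
    rcases Nat.lt_succ_iff_lt_or_eq.mp hn with hn | hn
    · rw [vanish _ _ _ _ (Hh_eq _ _ _ hS) hn, ht n hn]; simp
    · have : n = N := Fin.ext hn
      subst this
      have hcc := cc_ne d₁ d₂ m
      change _ + (cc d₁ d₂ m * c)⁻¹ • cc d₁ d₂ m • mu ((Om ^ m) (Dl ^ m * S)) = _
      rw [hl, hSp, smul_smul, smul_smul, mul_assoc, inv_mul_cancel₀ (mul_ne_zero hcc hc)]
      simp

/-- The Clebsch–Gordan decomposition for `SL₂(ℂ)`: the linear map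
`V(d₁) ⊗ V(d₂) → ⊕_{n=0}^{min(d₁,d₂)} V(d₁+d₂−2n)` induced by
`f ⊗ g ↦ (ψ_n(f,g))_n` exists, and any such map is a linear isomorphism and is
`SL₂(ℂ)`-equivariant (for the diagonal action on the tensor product and the componentwise
action on the direct sum). -/
theorem stmt13 (d₁ d₂ : ℕ) :
    (∃ Φ : (Vd d₁ ⊗[ℂ] Vd d₂) →ₗ[ℂ] (∀ n : Fin (min d₁ d₂ + 1), Vd (d₁ + d₂ - 2 * n.val)),
      ∀ (F : Vd d₁) (G : Vd d₂) (n : Fin (min d₁ d₂ + 1)),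
        ((Φ (F ⊗ₜ[ℂ] G)) n : P2) = ψ d₁ d₂ n.val F.val G.val) ∧
    (∀ Φ : (Vd d₁ ⊗[ℂ] Vd d₂) →ₗ[ℂ] (∀ n : Fin (min d₁ d₂ + 1), Vd (d₁ + d₂ - 2 * n.val)),
      (∀ (F : Vd d₁) (G : Vd d₂) (n : Fin (min d₁ d₂ + 1)),
        ((Φ (F ⊗ₜ[ℂ] G)) n : P2) = ψ d₁ d₂ n.val F.val G.val) →
      Function.Bijective Φ ∧
      ∀ (A : SL(2, ℂ)) (F : Vd d₁) (G : Vd d₂)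
        (hF : ρ A F.val ∈ Vd d₁) (hG : ρ A G.val ∈ Vd d₂) (n : Fin (min d₁ d₂ + 1)),
        ((Φ ((⟨ρ A F.val, hF⟩ : Vd d₁) ⊗ₜ[ℂ] (⟨ρ A G.val, hG⟩ : Vd d₂))) n : P2) =
          ρ A ((Φ (F ⊗ₜ[ℂ] G)) n : P2)) := by

  refine ⟨⟨LinearMap.pi fun n => LinearMap.codRestrict _
    (cc d₁ d₂ n.val • (mu ∘ₗ (Om ^ n.val) ∘ₗ io d₁ d₂))
    (comp_mem d₁ d₂ n.val (by omega)), ?_⟩, ?_⟩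
  · intro F G n
    rw [psi_eq]
    rfl
  · intro Φ hΦ
    have key : ∀ t n, ((Φ t) n : P2) = cc d₁ d₂ n.val • mu ((Om ^ n.val) (io d₁ d₂ t)) := by
      intro t n
      induction t using TensorProduct.induction_on with
      | zero => simp
      | add x y hx hy =>
        rw [map_add, Pi.add_apply, Submodule.coe_add, hx, hy, map_add, map_add, map_add, smul_add]
      | tmul f g => rw [hΦ, psi_eq]; rfl
    constructor
    · have hs : Function.Surjective Φ := by
        intro h
        obtain ⟨t, ht⟩ := surj d₁ d₂ Φ key h _ le_rfl
        exact ⟨t, funext fun n => ht n n.2⟩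
      have e := LinearEquiv.ofFinrankEq _ _ (finrank_eq d₁ d₂)
      have hi : Function.Injective Φ :=
        OrzechProperty.injective_of_surjective_of_injective e.toLinearMap Φ e.injective hs
      exact ⟨hi, hs⟩
    · intro A F G hF hG n
      rw [hΦ, hΦ]
      exact psi_rho A d₁ d₂ n.val F.val G.val
end
end
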